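/- arXiv:1706.03808 — 2 statements merged into one kernel-verified Lean document; each statement's English description precedes it below -/
import Mathlib

section
/- Every bridgeless graph G admits a circuit cover of total length at most 5/3 · |E(G)|, where a circuit cover is a collection of circuits such that every edge of G belongs to at least one circuit, and the total length is the sum of the numbers of edges of the circuits. -/
open Finset
open scoped Classical

noncomputable section

namespace SignedCircuitCover

variable {V E : Type} [Fintype V] [Fintype E] [DecidableEq V] [DecidableEq E]

/-- `e` is a loop. -/
def IsLoop (ends : E → Sym2 V) (e : E) : Prop := (ends e).IsDiag

/-- The vertices incident with an edge of `F`. -/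
def support (ends : E → Sym2 V) (F : Finset E) : Finset V :=
  Finset.univ.filter fun v => ∃ e ∈ F, v ∈ ends e

/-- Degree of `v` in the subgraph with edge set `F` (a loop counts twice). -/
def degree (ends : E → Sym2 V) (F : Finset E) (v : V) : ℕ :=
  ∑ e ∈ F, (if ends e = Sym2.diag v then 2 else if v ∈ ends e then 1 else 0)

/-- Reachability inside the edge set `F`. -/
def Reach (ends : E → Sym2 V) (F : Finset E) : V → V → Prop :=
  Relation.ReflTransGen fun a b => ∃ e ∈ F, ends e = s(a, b)

/-- The subgraph with edge set `F` is connected. -/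
def ConnectedOn (ends : E → Sym2 V) (F : Finset E) : Prop :=
  ∀ u ∈ support ends F, ∀ v ∈ support ends F, Reach ends F u v

/-- The whole graph is connected. -/
def Connected (ends : E → Sym2 V) : Prop :=
  ∀ u v : V, Reach ends (Finset.univ : Finset E) u v

/-- `F` is the edge set of a circuit (connected, 2-regular; a loop is a circuit). -/
def IsCircuit (ends : E → Sym2 V) (F : Finset E) : Prop :=
  F.Nonempty ∧ ConnectedOn ends F ∧ ∀ v ∈ support ends F, degree ends F v = 2

/-- `F` is the edge set of an Eulerian subgraph (connected, all degrees even). -/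
def IsEulerianOn (ends : E → Sym2 V) (F : Finset E) : Prop :=
  ConnectedOn ends F ∧ ∀ v ∈ support ends F, Even (degree ends F v)

/-- Negative edges of `F` (`sgn e = true` means `e` is negative). -/
def negEdges (sgn : E → Bool) (F : Finset E) : Finset E := F.filter fun e => sgn e = true

def IsBalancedCircuit (ends : E → Sym2 V) (sgn : E → Bool) (F : Finset E) : Prop :=
  IsCircuit ends F ∧ Even (negEdges sgn F).card

def IsUnbalancedCircuit (ends : E → Sym2 V) (sgn : E → Bool) (F : Finset E) : Prop :=
  IsCircuit ends F ∧ Odd (negEdges sgn F).card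

/-- `P` is the edge set of a path with (distinct) end-vertices `u` and `v`. -/
def IsPath (ends : E → Sym2 V) (P : Finset E) (u v : V) : Prop :=
  P.Nonempty ∧ ConnectedOn ends P ∧ u ≠ v ∧
    u ∈ support ends P ∧ v ∈ support ends P ∧
    degree ends P u = 1 ∧ degree ends P v = 1 ∧
    ∀ w ∈ support ends P, w ≠ u → w ≠ v → degree ends P w = 2

/-- A short barbell: two unbalanced circuits meeting at exactly one vertex. -/
def IsShortBarbell (ends : E → Sym2 V) (sgn : E → Bool) (F : Finset E) : Prop :=
  ∃ C₁ C₂ : Finset E, Disjoint C₁ C₂ ∧ F = C₁ ∪ C₂ ∧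
    IsUnbalancedCircuit ends sgn C₁ ∧ IsUnbalancedCircuit ends sgn C₂ ∧
    ∃ v : V, support ends C₁ ∩ support ends C₂ = {v}

/-- A long barbell: two disjoint unbalanced circuits joined by a path meeting
them only at its end-vertices. -/
def IsLongBarbell (ends : E → Sym2 V) (sgn : E → Bool) (F : Finset E) : Prop :=
  ∃ (C₁ C₂ P : Finset E) (u v : V),
    Disjoint C₁ C₂ ∧ Disjoint C₁ P ∧ Disjoint C₂ P ∧ F = C₁ ∪ C₂ ∪ P ∧
    IsUnbalancedCircuit ends sgn C₁ ∧ IsUnbalancedCircuit ends sgn C₂ ∧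
    Disjoint (support ends C₁) (support ends C₂) ∧
    IsPath ends P u v ∧
    support ends P ∩ support ends C₁ = {u} ∧
    support ends P ∩ support ends C₂ = {v}

def IsBarbell (ends : E → Sym2 V) (sgn : E → Bool) (F : Finset E) : Prop :=
  IsShortBarbell ends sgn F ∨ IsLongBarbell ends sgn F

/-- A signed circuit: a balanced circuit, a short barbell or a long barbell. -/
def IsSignedCircuit (ends : E → Sym2 V) (sgn : E → Bool) (F : Finset E) : Prop :=
  IsBalancedCircuit ends sgn F ∨ IsShortBarbell ends sgn F ∨ IsLongBarbell ends sgn F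

/-- `e` is a bridge (cut-edge) of the subgraph with edge set `F`. -/
def IsBridgeIn (ends : E → Sym2 V) (F : Finset E) (e : E) : Prop :=
  e ∈ F ∧ ∀ a b : V, ends e = s(a, b) → ¬ Reach ends (F.erase e) a b

/-- The bridges of the whole graph. -/
def bridges (ends : E → Sym2 V) : Finset E :=
  Finset.univ.filter fun e => IsBridgeIn ends Finset.univ e

/-- The non-bridge edges of the whole graph. -/
def nonbridges (ends : E → Sym2 V) : Finset E := Finset.univ \ bridges ends

/-- Reachability inside `F` avoiding the vertex `x`. -/
def ReachAvoid (ends : E → Sym2 V) (F : Finset E) (x : V) : V → V → Prop :=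
  Relation.ReflTransGen fun a b => a ≠ x ∧ b ≠ x ∧ ∃ e ∈ F, ends e = s(a, b)

/-- `x` is a cut-vertex of the subgraph with edge set `F`. -/
def IsCutVertexOn (ends : E → Sym2 V) (F : Finset E) (x : V) : Prop :=
  ∃ a ∈ support ends F, ∃ b ∈ support ends F,
    a ≠ x ∧ b ≠ x ∧ Reach ends F a b ∧ ¬ ReachAvoid ends F x a b

/-- The subgraph with edge set `F` is 2-connected (connected and without cut-vertices). -/
def TwoConnectedOn (ends : E → Sym2 V) (F : Finset E) : Prop :=
  ConnectedOn ends F ∧ ∀ x : V, ¬ IsCutVertexOn ends F x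

/-- The whole graph is 2-connected. -/
def TwoConnected (ends : E → Sym2 V) : Prop :=
  Connected ends ∧ ∀ x : V, ¬ IsCutVertexOn ends (Finset.univ : Finset E) x

/-- Total length of a collection of subgraphs. -/
def totalLength (𝒞 : List (Finset E)) : ℕ := (𝒞.map Finset.card).sum

/-- The width of the edge `e` with respect to the collection `𝒞`. -/
def widthAt (𝒞 : List (Finset E)) (e : E) : ℕ := (𝒞.filter fun C => e ∈ C).length

/-- `𝒞` covers every edge of the graph. -/
def CoversAll (𝒞 : List (Finset E)) : Prop := ∀ e : E, ∃ C ∈ 𝒞, e ∈ C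

/-- A tree of Eulerian graphs: connected, and after deleting all bridges every
component is Eulerian (equivalently all degrees in the bridgeless part are even). -/
def IsTreeOfEulerian (ends : E → Sym2 V) : Prop :=
  Connected ends ∧ ∀ v : V, Even (degree ends (nonbridges ends) v)

/-- Non-bridge non-loop edges. -/
def nbnl (ends : E → Sym2 V) : Finset E :=
  (nonbridges ends).filter fun e => ¬ IsLoop ends e

/-- A tree of circuits: connected, and after deleting all bridges and loops every
vertex has degree 0 or 2 (each component is an isolated vertex or a circuit). -/
def IsTreeOfCircuits (ends : E → Sym2 V) : Prop :=
  Connected ends ∧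
    ∀ v : V, degree ends (nbnl ends) v = 0 ∨ degree ends (nbnl ends) v = 2

/-- The balloon containing `v`: the edge set of the component of `v` in the
graph of non-bridge non-loop edges. -/
def compBalloon (ends : E → Sym2 V) (v : V) : Finset E :=
  (nbnl ends).filter fun e => ∃ w ∈ ends e, Reach ends (nbnl ends) v w

/-- Valency of the balloon of `v`: the number of bridges and loops incident
with its component. -/
def balloonValency (ends : E → Sym2 V) (v : V) : ℕ :=
  (Finset.univ.filter fun e =>
    (IsBridgeIn ends Finset.univ e ∨ IsLoop ends e) ∧
      ∃ w ∈ ends e, Reach ends (nbnl ends) v w).card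

/-- A balloon consisting of a single negative loop. -/
def IsNegLoopBalloon (ends : E → Sym2 V) (sgn : E → Bool) (B : Finset E) : Prop :=
  ∃ e : E, IsLoop ends e ∧ sgn e = true ∧ B = {e}

/-- A leaf balloon: a negative loop, or a nontrivial balloon of valency 1. -/
def IsLeafBalloon (ends : E → Sym2 V) (sgn : E → Bool) (B : Finset E) : Prop :=
  IsNegLoopBalloon ends sgn B ∨
    ∃ v : V, B = compBalloon ends v ∧ B.Nonempty ∧ balloonValency ends v = 1

/-- A leaf circuit: a negative loop, or a balloon of valency 1 which is a circuit. -/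
def IsLeafCircuit (ends : E → Sym2 V) (sgn : E → Bool) (B : Finset E) : Prop :=
  IsNegLoopBalloon ends sgn B ∨
    ∃ v : V, B = compBalloon ends v ∧ IsCircuit ends B ∧ balloonValency ends v = 1

/-- An inner circuit: a balloon of valency at least 2 which is a circuit. -/
def IsInnerCircuit (ends : E → Sym2 V) (B : Finset E) : Prop :=
  ∃ v : V, B = compBalloon ends v ∧ IsCircuit ends B ∧ 2 ≤ balloonValency ends v

/-- Number of unbalanced circuits of a tree of circuits: negative loops together
with the unbalanced (nontrivial) balloons. -/
def numUnbalancedCircuits (ends : E → Sym2 V) (sgn : E → Bool) : ℕ :=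
  (Finset.univ.filter fun e : E => IsLoop ends e ∧ sgn e = true).card +
    Set.ncard {B : Finset E |
      (∃ v : V, B = compBalloon ends v) ∧ B.Nonempty ∧ Odd (negEdges sgn B).card}

/-- Flow-admissibility: every edge lies in a signed circuit (Bouchet). -/
def FlowAdmissible (ends : E → Sym2 V) (sgn : E → Bool) : Prop :=
  ∀ e : E, ∃ C : Finset E, IsSignedCircuit ends sgn C ∧ e ∈ C

/-- `e` has exactly one end-vertex in `U`. -/
def crosses (ends : E → Sym2 V) (U : Finset V) (e : E) : Prop :=
  ∃ a b : V, ends e = s(a, b) ∧ ((a ∈ U ∧ b ∉ U) ∨ (a ∉ U ∧ b ∈ U))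

/-- Switching the signature at the vertex set `U`. -/
def switch (ends : E → Sym2 V) (U : Finset V) (sgn : E → Bool) : E → Bool :=
  fun e => if crosses ends U e then ! (sgn e) else sgn e

/-- The number of negative edges of a signature. -/
def negCount (sgn : E → Bool) : ℕ := (Finset.univ.filter fun e => sgn e = true).card

/-- `sgn` is a minimum signature: no equivalent (switched) signature has fewer
negative edges. -/
def IsMinSignature (ends : E → Sym2 V) (sgn : E → Bool) : Prop :=
  ∀ U : Finset V, negCount sgn ≤ negCount (switch ends U sgn)

/-- `{e₁, e₂}` is a 2-edge-cut of the subgraph with edge set `F`. -/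
def IsTwoEdgeCut (ends : E → Sym2 V) (F : Finset E) (e₁ e₂ : E) : Prop :=
  e₁ ≠ e₂ ∧ e₁ ∈ F ∧ e₂ ∈ F ∧ ¬ IsBridgeIn ends F e₁ ∧ ¬ IsBridgeIn ends F e₂ ∧
    (∀ a b : V, ends e₁ = s(a, b) → ¬ Reach ends ((F.erase e₁).erase e₂) a b) ∧
    (∀ a b : V, ends e₂ = s(a, b) → ¬ Reach ends ((F.erase e₁).erase e₂) a b)

/-- `b` is a bridge of `F` whose removal leaves two parts which are both unbalanced. -/
def SeparatesUnbalanced (ends : E → Sym2 V) (sgn : E → Bool) (F : Finset E) (b : E) : Prop :=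
  IsBridgeIn ends F b ∧
    ∀ a c : V, ends b = s(a, c) →
      (∃ C ⊆ F.erase b, IsUnbalancedCircuit ends sgn C ∧
        ∃ w ∈ support ends C, Reach ends (F.erase b) a w) ∧
      (∃ C ⊆ F.erase b, IsUnbalancedCircuit ends sgn C ∧
        ∃ w ∈ support ends C, Reach ends (F.erase b) c w)

/-- `T` is a spanning tree of the whole graph: spanning, connected and acyclic. -/
def IsSpanningTree (ends : E → Sym2 V) (T : Finset E) : Prop :=
  (∀ u v : V, Reach ends T u v) ∧ ∀ C ⊆ T, ¬ IsCircuit ends C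


section Flow

set_option linter.unusedSectionVars false

variable {M : Type} [AddCommGroup M]

def bd (s t : E → V) (f : E → M) (v : V) : M :=
  ∑ e, ((if t e = v then f e else 0) - (if s e = v then f e else 0))

def cut (s t : E → V) (S : Finset V) : Finset E :=
  Finset.univ.filter fun e => ¬ (s e ∈ S ↔ t e ∈ S)


lemma bd_add (s t : E → V) (f g : E → M) (v : V) :
    bd s t (fun e => f e + g e) v = bd s t f v + bd s t g v := by
  unfold bd
  rw [← Finset.sum_add_distrib]
  refine Finset.sum_congr rfl fun e _ => ?_
  dsimp only
  split_ifs <;> abel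

lemma bd_sub (s t : E → V) (f g : E → M) (v : V) :
    bd s t (fun e => f e - g e) v = bd s t f v - bd s t g v := by
  unfold bd
  rw [← Finset.sum_sub_distrib]
  refine Finset.sum_congr rfl fun e _ => ?_
  dsimp only
  split_ifs <;> abel

lemma bd_single (s t : E → V) (e : E) (m : M) (v : V) :
    bd s t (fun e' => if e' = e then m else 0) v
      = (if t e = v then m else 0) - (if s e = v then m else 0) := by
  unfold bd
  rw [Finset.sum_eq_single e]
  · simp
  · intro b _ hb
    simp [hb]
  · simp

lemma bd_mul {R : Type} [CommRing R] (s t : E → V) (c : R) (f : E → R) (v : V) :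
    bd s t (fun e => c * f e) v = c * bd s t f v := by
  unfold bd
  rw [Finset.mul_sum]
  refine Finset.sum_congr rfl fun e _ => ?_
  split_ifs <;> ring

lemma bd_sum {ι : Type} (s t : E → V) (A : Finset ι) (f : ι → E → M) (v : V) :
    bd s t (fun e => ∑ i ∈ A, f i e) v = ∑ i ∈ A, bd s t (f i) v := by
  unfold bd
  rw [Finset.sum_comm]
  refine Finset.sum_congr rfl fun e _ => ?_
  split_ifs <;> simp

lemma bd_cast (k : ℕ) (s t : E → V) (f : E → ℤ) (v : V) :
    bd s t (fun e => (f e : ZMod k)) v = ((bd s t f v : ℤ) : ZMod k) := by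
  unfold bd
  push_cast
  rfl

lemma sum_bd (s t : E → V) (f : E → M) (S : Finset V) :
    ∑ v ∈ S, bd s t f v
      = ∑ e, ((if t e ∈ S then f e else 0) - (if s e ∈ S then f e else 0)) := by
  unfold bd
  rw [Finset.sum_comm]
  refine Finset.sum_congr rfl fun e _ => ?_
  rw [Finset.sum_sub_distrib]
  simp

lemma sum_bd_univ (s t : E → V) (f : E → M) : ∑ v, bd s t f v = 0 := by
  rw [sum_bd]; simp

lemma bd_comp (s t : E → V) (φ : V → V) (f : E → M) (w : V) :
    bd (fun e => φ (s e)) (fun e => φ (t e)) f w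
      = ∑ v ∈ Finset.univ.filter (fun v => φ v = w), bd s t f v := by
  rw [sum_bd]
  unfold bd
  simp

lemma bd_zero_of (s t : E → V) (f : E → M) (v : V)
    (h : ∀ e, f e ≠ 0 → s e ≠ v ∧ t e ≠ v) : bd s t f v = 0 := by
  unfold bd
  refine Finset.sum_eq_zero fun e _ => ?_
  by_cases hf : f e = 0
  · simp [hf]
  · simp [h e hf]

/-- restriction to a closed vertex set -/
lemma bd_restrict (s t : E → V) (f : E → M) (A : Finset V)
    (h : ∀ e, f e ≠ 0 → (s e ∈ A ↔ t e ∈ A)) (v : V) :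
    bd s t (fun e => if s e ∈ A then f e else 0) v = if v ∈ A then bd s t f v else 0 := by
  by_cases hv : v ∈ A
  · rw [if_pos hv]
    unfold bd
    refine Finset.sum_congr rfl fun e _ => ?_
    by_cases hf : f e = 0
    · simp [hf]
    · have := h e hf
      by_cases h1 : t e = v <;> by_cases h2 : s e = v <;> simp_all
  · rw [if_neg hv]
    refine bd_zero_of _ _ _ _ fun e he => ?_
    have h1 : s e ∈ A := by by_contra h1; simp [h1] at he
    have h2 : f e ≠ 0 := by simpa [h1] using he
    have h3 := (h e h2).1 h1
    constructor
    · rintro rfl; exact hv h1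
    · rintro rfl; exact hv h3

lemma augment (s t : E → V) (g lo hi : E → ℤ) (k : ℤ) (hk : 0 < k) (x : V)
    (hg : ∀ e, lo e ≤ g e ∧ g e ≤ hi e) :
    ∃ R : Finset V, x ∈ R ∧
      (∀ z ∈ R, ∃ g' : E → ℤ, (∀ e, lo e ≤ g' e ∧ g' e ≤ hi e) ∧ (∀ e, k ∣ g' e - g e) ∧
        ∀ v, bd s t g' v = bd s t g v + k * ((if z = v then 1 else 0) - (if x = v then 1 else 0))) ∧
      ∀ e, (s e ∈ R → t e ∉ R → hi e < g e + k) ∧ (t e ∈ R → s e ∉ R → g e - k < lo e) := by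
  let Q : Finset V → Prop := fun R => x ∈ R ∧
      (∀ z ∈ R, ∃ g' : E → ℤ, (∀ e, lo e ≤ g' e ∧ g' e ≤ hi e) ∧ (∀ e, k ∣ g' e - g e) ∧
        (∀ e, ¬ (s e ∈ R ∧ t e ∈ R) → g' e = g e) ∧
        ∀ v, bd s t g' v = bd s t g v + k * ((if z = v then 1 else 0) - (if x = v then 1 else 0)))
  have h0 : Q {x} := by
    refine ⟨by simp, fun z hz => ⟨g, hg, by simp, by simp, ?_⟩⟩
    simp at hz
    subst hz
    simp
  obtain ⟨R, hR, hmax⟩ := Finset.exists_max_image (Finset.univ.filter Q) Finset.card ⟨{x}, by simpa using h0⟩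
  have hQ : Q R := by simpa using hR
  have hstep : ∀ z ∈ R, ∀ z' ∉ R, ∀ e, ∀ d : ℤ, k ∣ d → lo e ≤ g e + d → g e + d ≤ hi e →
      ¬ (s e ∈ R ∧ t e ∈ R) → s e ∈ insert z' R → t e ∈ insert z' R →
      (∀ v, bd s t (fun e' => if e' = e then d else 0) v
        = k * ((if z' = v then 1 else 0) - (if z = v then 1 else 0))) → False := by
    intro z hz z' hz' e d hd hlo hhi hne hs ht hb
    have hQ' : Q (insert z' R) := by
      refine ⟨by simp [hQ.1], fun y hy => ?_⟩
      rw [Finset.mem_insert] at hy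
      rcases hy with rfl | hy
      · obtain ⟨g', h1, h2, h3, h4⟩ := hQ.2 z hz
        refine ⟨fun e' => g' e' + (if e' = e then d else 0), ?_, ?_, ?_, ?_⟩
        · intro e'
          by_cases he : e' = e
          · subst he; simp [h3 _ hne, hlo, hhi]
          · simpa [he] using h1 e'
        · intro e'
          by_cases he : e' = e
          · subst he; simp [h3 _ hne, hd]
          · simpa [he] using h2 e'
        · intro e' he'
          have : e' ≠ e := by rintro rfl; exact he' ⟨hs, ht⟩
          simp only [this, if_false, add_zero]
          apply h3
          rintro ⟨a, b⟩
          exact he' ⟨by simp [a], by simp [b]⟩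
        · intro v
          rw [bd_add, h4, hb]; ring
      · obtain ⟨g', h1, h2, h3, h4⟩ := hQ.2 y hy
        refine ⟨g', h1, h2, fun e' he' => h3 e' ?_, h4⟩
        rintro ⟨a, b⟩
        exact he' ⟨by simp [a], by simp [b]⟩
    have := hmax (insert z' R) (by simpa using hQ')
    rw [Finset.card_insert_of_notMem hz'] at this
    omega
  refine ⟨R, hQ.1, fun z hz => ?_, fun e => ⟨fun hs ht => ?_, fun ht hs => ?_⟩⟩
  · obtain ⟨g', h1, h2, _, h4⟩ := hQ.2 z hz
    exact ⟨g', h1, h2, h4⟩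
  · by_contra hcon
    refine hstep (s e) hs (t e) ht e k (dvd_refl k) (by have := hg e; omega) (by omega)
      (by simp [ht]) (by simp [hs]) (by simp) fun v => ?_
    rw [bd_single]
    split_ifs <;> ring
  · by_contra hcon
    refine hstep (t e) ht (s e) hs e (-k) (by simp) (by omega) (by have := hg e; omega)
      (by simp [hs]) (by simp) (by simp [ht]) fun v => ?_
    rw [bd_single]
    split_ifs <;> ring

lemma twoflow_step (s t : E → V) (F : Finset E) (x y : V)
    (hcut : ∀ S : Finset V, x ∈ S → y ∉ S → 2 ≤ (cut s t S ∩ F).card) (j : ℤ) (hj : j ≤ 1)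
    (f : E → ℤ) (hf : ∀ e, -(if e ∈ F then 1 else 0) ≤ f e ∧ f e ≤ (if e ∈ F then 1 else 0))
    (hb : ∀ v, bd s t f v = j * ((if y = v then 1 else 0) - (if x = v then 1 else 0))) :
    ∃ f' : E → ℤ, (∀ e, -(if e ∈ F then 1 else 0) ≤ f' e ∧ f' e ≤ (if e ∈ F then 1 else 0)) ∧
      ∀ v, bd s t f' v = (j + 1) * ((if y = v then 1 else 0) - (if x = v then 1 else 0)) := by
  obtain ⟨R, hx, h1, h2⟩ := augment s t f _ _ 1 one_pos x hf
  by_cases hy : y ∈ R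
  · obtain ⟨g', ha, _, hc⟩ := h1 y hy
    exact ⟨g', ha, fun v => by rw [hc, hb]; ring⟩
  · exfalso
    have h3 := sum_bd s t f R
    have h4 : ∑ v ∈ R, bd s t f v = - j := by
      simp only [hb]
      rw [← Finset.mul_sum, Finset.sum_sub_distrib]
      simp [hx, hy]
    have h5 : ∑ e, ((if t e ∈ R then f e else 0) - (if s e ∈ R then f e else 0))
        = - ((cut s t R ∩ F).card : ℤ) := by
      have : cut s t R ∩ F = Finset.univ.filter (fun e => ¬ (s e ∈ R ↔ t e ∈ R) ∧ e ∈ F) := by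
        ext e; simp [cut]
      rw [this, Finset.card_filter]
      push_cast
      rw [← Finset.sum_neg_distrib]
      refine Finset.sum_congr rfl fun e _ => ?_
      have a := h2 e
      have b := hf e
      by_cases hs : s e ∈ R <;> by_cases ht : t e ∈ R <;> by_cases hF : e ∈ F <;>
        simp [hs, ht, hF] at a b ⊢ <;> omega
    have := hcut R hx hy
    rw [h4, h5] at h3
    omega

lemma twoflow (s t : E → V) (F : Finset E) (x y : V)
    (hcut : ∀ S : Finset V, x ∈ S → y ∉ S → 2 ≤ (cut s t S ∩ F).card) :
    ∃ f : E → ℤ, (∀ e, -(if e ∈ F then 1 else 0) ≤ f e ∧ f e ≤ (if e ∈ F then 1 else 0)) ∧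
      ∀ v, bd s t f v = 2 * ((if y = v then 1 else 0) - (if x = v then 1 else 0)) := by
  obtain ⟨f1, a1, b1⟩ := twoflow_step s t F x y hcut 0 (by norm_num) (fun _ => 0)
    (by intro e; split_ifs <;> simp) (by intro v; simp [bd])
  obtain ⟨f2, a2, b2⟩ := twoflow_step s t F x y hcut _ (by norm_num) f1 a1 b1
  exact ⟨f2, a2, fun v => by rw [b2]; ring⟩

lemma exists_int_flow (s t : E → V) (k : ℕ) (hk : 0 < k) (ψ : E → ZMod k)
    (hψ : ∀ v, bd s t ψ v = 0) :
    ∃ g : E → ℤ, (∀ e, (g e : ZMod k) = ψ e) ∧ (∀ e, |g e| < k) ∧ ∀ v, bd s t g v = 0 := by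
  have : NeZero k := ⟨hk.ne'⟩
  let Q : (E → ℤ) → Prop := fun g => (∀ e, (g e : ZMod k) = ψ e) ∧ ∀ e, |g e| < k
  let μ : (E → ℤ) → ℕ := fun g => ∑ v, (bd s t g v).natAbs
  have h0 : ∃ g, Q g := by
    refine ⟨fun e => ((ψ e).val : ℤ), fun e => by simp, fun e => ?_⟩
    have := ZMod.val_lt (ψ e)
    rw [abs_of_nonneg (by positivity)]
    change ((ψ e).val : ℤ) < k
    exact_mod_cast this
  obtain ⟨g, hg, hmin⟩ : ∃ g, Q g ∧ ∀ g', Q g' → μ g ≤ μ g' := by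
    have hne : Set.Nonempty {g | Q g} := h0
    exact ⟨Function.argminOn μ {g | Q g} hne, Function.argminOn_mem μ _ hne,
      fun g' hg' => Function.argminOn_le μ {g | Q g} hg'⟩
  refine ⟨g, hg.1, hg.2, ?_⟩
  have hdvd : ∀ v, (k : ℤ) ∣ bd s t g v := by
    intro v
    rw [← ZMod.intCast_zmod_eq_zero_iff_dvd, ← bd_cast]
    simp only [hg.1]
    exact hψ v
  by_contra hcon
  push Not at hcon
  obtain ⟨x, hx⟩ : ∃ x, 0 < bd s t g x := by
    by_contra hno
    push Not at hno
    obtain ⟨v, hv⟩ := hcon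
    exact hv ((Finset.sum_eq_zero_iff_of_nonpos fun v _ => hno v).1 (sum_bd_univ s t g) v (by simp))
  obtain ⟨R, hxR, h1, h2⟩ := augment s t g (fun _ => -((k : ℤ) - 1)) (fun _ => (k : ℤ) - 1) k
    (by exact_mod_cast hk) x (fun e => by have := abs_lt.1 (hg.2 e); constructor <;> linarith)
  by_cases hz : ∃ z ∈ R, bd s t g z < 0
  · obtain ⟨z, hzR, hz⟩ := hz
    obtain ⟨g', a, b, c⟩ := h1 z hzR
    have hQ' : Q g' := by
      refine ⟨fun e => ?_, fun e => ?_⟩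
      · rw [← hg.1 e, ZMod.intCast_eq_intCast_iff_dvd_sub]
        rw [← dvd_neg, neg_sub]; exact b e
      · have := a e
        rw [abs_lt]; constructor <;> omega
    have hle := hmin g' hQ'
    have hlt : μ g' < μ g := by
      have hxk := Int.le_of_dvd hx (hdvd x)
      have hzk := Int.le_of_dvd (neg_pos.2 hz) ((dvd_neg).2 (hdvd z))
      have hzx : z ≠ x := by rintro rfl; omega
      refine Finset.sum_lt_sum (fun v _ => ?_) ⟨x, by simp, ?_⟩
      · rw [c v]
        by_cases e1 : z = v
        · subst e1; simp [hzx.symm]; omega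
        · by_cases e2 : x = v
          · subst e2; simp [e1]; omega
          · simp [e1, e2]
      · rw [c x]; simp [hzx]; omega
    omega
  · push Not at hz
    have h3 := sum_bd s t g R
    have h4 : 0 < ∑ v ∈ R, bd s t g v :=
      Finset.sum_pos' hz ⟨x, hxR, hx⟩
    have h5 : ∑ e, ((if t e ∈ R then g e else 0) - (if s e ∈ R then g e else 0)) ≤ 0 := by
      refine Finset.sum_nonpos fun e _ => ?_
      have a := h2 e
      by_cases hs : s e ∈ R <;> by_cases ht : t e ∈ R <;> simp [hs, ht] at a ⊢ <;> omega
    omega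

end Flow

section Six

set_option linter.unusedSectionVars false

lemma zmod3_choose : ∀ a b u v : ZMod 3, u ≠ 0 → v ≠ 0 → ∃ c : ZMod 3, a + c * u ≠ 0 ∧ b + c * v ≠ 0 := by
  decide

lemma edge_chain (s t : E → V) (x r : V) (e1 : E)
    (he1 : (s e1 = x ∧ t e1 = r) ∨ (s e1 = r ∧ t e1 = x)) :
    ∃ k : E → ZMod 3, k e1 ≠ 0 ∧ (∀ e, e ≠ e1 → k e = 0) ∧
      ∀ v, bd s t k v = (if x = v then 1 else 0) - (if r = v then 1 else 0) := by
  rcases he1 with ⟨h1, h2⟩ | ⟨h1, h2⟩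
  · refine ⟨fun e => if e = e1 then -1 else 0, by simp, fun e he => by simp [he], fun v => ?_⟩
    rw [bd_single, h1, h2]
    split_ifs <;> ring
  · refine ⟨fun e => if e = e1 then 1 else 0, by simp, fun e he => by simp [he], fun v => ?_⟩
    rw [bd_single, h1, h2]

def Good (s t : E → V) (r : V) : Prop :=
  ∃ (c : E → ZMod 2) (ψ : E → ZMod 3), (∀ v, bd s t c v = 0) ∧ (∀ v, bd s t ψ v = 0) ∧
    (∀ e, c e ≠ 0 → s e ≠ r ∧ t e ≠ r ∧ s e ≠ t e) ∧ ∀ e, c e ≠ 0 ∨ ψ e ≠ 0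

lemma good_ext (s t : E → V) (r : V) (A : Finset V) (hr : r ∉ A) (x y : V) (hx : x ∈ A) (hy : y ∈ A)
    (e1 e2 : E) (hne : e1 ≠ e2)
    (he1 : (s e1 = x ∧ t e1 = r) ∨ (s e1 = r ∧ t e1 = x))
    (he2 : (s e2 = y ∧ t e2 = r) ∨ (s e2 = r ∧ t e2 = y))
    (D : Finset E) (hD : ∀ e ∈ D, s e ∈ A ∧ t e ∈ A ∧ s e ≠ t e)
    (hDe : ∀ v, bd s t (fun e => if e ∈ D then (1 : ZMod 2) else 0) v = 0)
    (hconn : ∀ a ∈ A, ∃ h : E → ZMod 3, (∀ e, e ∉ D → h e = 0) ∧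
      ∀ v, bd s t h v = (if a = v then 1 else 0) - (if x = v then 1 else 0))
    (IH : Good (fun e => if s e ∈ A then r else s e) (fun e => if t e ∈ A then r else t e) r) :
    Good s t r := by
  obtain ⟨c', ψ', hc', hψ', hcr, hcov⟩ := IH
  have hcA : ∀ e, c' e ≠ 0 → s e ∉ A ∧ t e ∉ A ∧ s e ≠ r ∧ t e ≠ r ∧ s e ≠ t e := by
    intro e he
    obtain ⟨h1, h2, h3⟩ := hcr e he
    by_cases hs : s e ∈ A
    · simp [hs] at h1
    · by_cases ht : t e ∈ A
      · simp [ht] at h2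
      · simp [hs, ht] at h1 h2 h3
        exact ⟨hs, ht, h1, h2, h3⟩
  have hfib : ∀ w, w ∉ A → w ≠ r → Finset.univ.filter (fun v => (if v ∈ A then r else v) = w) = {w} := by
    intro w hw hwr
    ext v
    simp only [Finset.mem_filter, Finset.mem_univ, true_and, Finset.mem_singleton]
    split_ifs with h
    · constructor
      · rintro rfl; exact absurd rfl hwr
      · rintro rfl; exact absurd h hw
    · rfl
  have hfibr : Finset.univ.filter (fun v => (if v ∈ A then r else v) = r) = insert r A := by
    ext v
    simp only [Finset.mem_filter, Finset.mem_univ, true_and, Finset.mem_insert]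
    split_ifs with h <;> simp [h]
  have hcG : ∀ v, bd s t c' v = 0 := by
    intro v
    by_cases hv : v ∉ A ∧ v ≠ r
    · have := hc' v
      rw [bd_comp s t (fun v => if v ∈ A then r else v), hfib v hv.1 hv.2] at this
      simpa using this
    · refine bd_zero_of _ _ _ _ fun e he => ?_
      obtain ⟨h1, h2, h3, h4, _⟩ := hcA e he
      constructor
      · rintro rfl; exact hv ⟨h1, h3⟩
      · rintro rfl; exact hv ⟨h2, h4⟩
  have hψo : ∀ v, v ∉ A → v ≠ r → bd s t ψ' v = 0 := by
    intro v hv hvr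
    have := hψ' v
    rw [bd_comp s t (fun v => if v ∈ A then r else v), hfib v hv hvr] at this
    simpa using this
  have hψr : bd s t ψ' r + ∑ a ∈ A, bd s t ψ' a = 0 := by
    have := hψ' r
    rw [bd_comp s t (fun v => if v ∈ A then r else v), hfibr, Finset.sum_insert hr] at this
    exact this
  obtain ⟨k1, hk1, hk1', hk1b⟩ := edge_chain s t x r e1 he1
  obtain ⟨k2, hk2, hk2', hk2b⟩ := edge_chain s t y r e2 he2
  choose! h hh hhb using hconn
  let ψ1 : E → ZMod 3 := fun e => ψ' e - ∑ a ∈ A, bd s t ψ' a * (h a e + k1 e)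
  have hψ1 : ∀ v, bd s t ψ1 v = 0 := by
    intro v
    have e1 : bd s t ψ1 v = bd s t ψ' v - ∑ a ∈ A, bd s t ψ' a * ((if a = v then 1 else 0) - (if r = v then 1 else 0)) := by
      change bd s t (fun e => ψ' e - ∑ a ∈ A, bd s t ψ' a * (h a e + k1 e)) v = _
      rw [bd_sub, bd_sum]
      congr 1
      refine Finset.sum_congr rfl fun a ha => ?_
      rw [bd_mul, bd_add, hhb a ha, hk1b]
      ring
    rw [e1]
    simp only [mul_sub, Finset.sum_sub_distrib, mul_ite, mul_one, mul_zero, Finset.sum_ite_eq']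
    by_cases hv : v ∈ A
    · have : r ≠ v := by rintro rfl; exact hr hv
      simp [hv, this]
    · by_cases hvr : r = v
      · subst hvr
        simp [hr, hψr]
      · simp [hv, hvr, hψo v hv (Ne.symm hvr)]
  let cyc : E → ZMod 3 := fun e => (k1 e + h y e) - k2 e
  have hcyc : ∀ v, bd s t cyc v = 0 := by
    intro v
    change bd s t (fun e => (k1 e + h y e) - k2 e) v = 0
    rw [bd_sub, bd_add, hk1b, hk2b, hhb y hy]
    ring
  have hnD : ∀ e, (s e = r ∨ t e = r) → e ∉ D := by
    intro e he heD
    obtain ⟨a, b, _⟩ := hD e heD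
    rcases he with he | he
    · exact hr (he ▸ a)
    · exact hr (he ▸ b)
  have he1D : e1 ∉ D := hnD e1 (by tauto)
  have he2D : e2 ∉ D := hnD e2 (by tauto)
  have hcyc1 : cyc e1 ≠ 0 := by
    simp only [cyc, hh y hy e1 he1D, hk2' e1 hne]
    simpa using hk1
  have hcyc2 : cyc e2 ≠ 0 := by
    simp only [cyc, hh y hy e2 he2D, hk1' e2 hne.symm]
    simpa using hk2
  obtain ⟨q, hq1, hq2⟩ := zmod3_choose (ψ1 e1) (ψ1 e2) _ _ hcyc1 hcyc2
  refine ⟨fun e => c' e + (if e ∈ D then 1 else 0), fun e => ψ1 e + q * cyc e, ?_, ?_, ?_, ?_⟩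
  · intro v
    rw [bd_add, hcG, hDe, add_zero]
  · intro v
    rw [bd_add, bd_mul, hψ1, hcyc]; simp
  · intro e he
    by_cases heD : e ∈ D
    · obtain ⟨a, b, d⟩ := hD e heD
      exact ⟨fun h => hr (h ▸ a), fun h => hr (h ▸ b), d⟩
    · simp only [heD, if_false, add_zero] at he
      exact (hcA e he).2.2
  · intro e
    by_cases heD : e ∈ D
    · left
      have : c' e = 0 := by
        by_contra hne
        exact (hcA e hne).1 (hD e heD).1
      simp [this, heD]
    · by_cases h1 : e = e1
      · right; rw [h1]; exact hq1
      · by_cases h2 : e = e2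
        · right; rw [h2]; exact hq2
        · have hc0 : cyc e = 0 := by
            simp [cyc, hh y hy e heD, hk1' e h1, hk2' e h2]
          have hp0 : ψ1 e = ψ' e := by
            simp only [ψ1]
            rw [Finset.sum_eq_zero, sub_zero]
            intro a ha
            simp [hh a ha e heD, hk1' e h1]
          rcases hcov e with hc | hc
          · left; simpa [heD] using hc
          · right; simpa [hc0, hp0] using hc

def nonloops (s t : E → V) : Finset E := Finset.univ.filter fun e => s e ≠ t e

set_option maxHeartbeats 1600000 in
/-- the extension data exist -/
lemma exists_data (s t : E → V) (hcut : ∀ S : Finset V, cut s t S = ∅ ∨ 3 ≤ (cut s t S).card)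
    (r : V) (hr : ∃ e, s e ≠ t e ∧ (s e = r ∨ t e = r)) :
    ∃ (A : Finset V) (x y : V) (e1 e2 : E) (D : Finset E), r ∉ A ∧ x ∈ A ∧ y ∈ A ∧ e1 ≠ e2 ∧
      ((s e1 = x ∧ t e1 = r) ∨ (s e1 = r ∧ t e1 = x)) ∧
      ((s e2 = y ∧ t e2 = r) ∨ (s e2 = r ∧ t e2 = y)) ∧
      (∀ e ∈ D, s e ∈ A ∧ t e ∈ A ∧ s e ≠ t e) ∧
      (∀ v, bd s t (fun e => if e ∈ D then (1 : ZMod 2) else 0) v = 0) ∧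
      (∀ a ∈ A, ∃ h : E → ZMod 3, (∀ e, e ∉ D → h e = 0) ∧
        ∀ v, bd s t h v = (if a = v then 1 else 0) - (if x = v then 1 else 0)) := by
  let dW : Finset V → Finset E := fun B => Finset.univ.filter fun e =>
    ¬ (s e ∈ B ↔ t e ∈ B) ∧ s e ≠ r ∧ t e ≠ r
  let Q : Finset V → Prop := fun B => r ∉ B ∧ (cut s t B).Nonempty ∧ (dW B).card ≤ 1
  have hQ0 : Q (Finset.univ.erase r) := by
    refine ⟨by simp, ?_, ?_⟩
    · obtain ⟨e, hne, he⟩ := hr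
      refine ⟨e, ?_⟩
      simp only [cut, Finset.mem_filter, Finset.mem_univ, true_and, Finset.mem_erase, and_true]
      rcases he with he | he
      · subst he; simp [hne.symm]
      · subst he; simp [hne]
    · have : dW (Finset.univ.erase r) = ∅ := by
        ext e
        simp [dW]
        tauto
      simp [this]
  obtain ⟨B, hB, hmin⟩ := Finset.exists_min_image (Finset.univ.filter Q) Finset.card ⟨_, by simpa using hQ0⟩
  obtain ⟨hrB, hBne, hB1⟩ : Q B := by simpa using hB
  have hmin' : ∀ B', Q B' → B.card ≤ B'.card := fun B' h => hmin B' (by simpa using h)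
  have h3 : 3 ≤ (cut s t B).card := by
    rcases hcut B with h | h
    · rw [h] at hBne; simp at hBne
    · exact h
  have h2 : 1 < (cut s t B \ dW B).card := by
    have := Finset.le_card_sdiff (dW B) (cut s t B)
    omega
  obtain ⟨e1, he1, e2, he2, hne⟩ := Finset.one_lt_card.1 h2
  have hend : ∀ e ∈ cut s t B \ dW B, ∃ x ∈ B, (s e = x ∧ t e = r) ∨ (s e = r ∧ t e = x) := by
    intro e he
    simp only [cut, dW, Finset.mem_sdiff, Finset.mem_filter, Finset.mem_univ, true_and] at he
    obtain ⟨ha, hb⟩ := he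
    by_cases hs : s e ∈ B
    · have ht : t e ∉ B := by tauto
      have : s e ≠ r := by rintro h; exact hrB (h ▸ hs)
      exact ⟨s e, hs, Or.inl ⟨rfl, by tauto⟩⟩
    · have ht : t e ∈ B := by tauto
      have : t e ≠ r := by rintro h; exact hrB (h ▸ ht)
      exact ⟨t e, ht, Or.inr ⟨by tauto, rfl⟩⟩
  obtain ⟨x, hxB, hx⟩ := hend e1 he1
  obtain ⟨y, hyB, hy⟩ := hend e2 he2
  let F : Finset E := Finset.univ.filter fun e => s e ∈ B ∧ t e ∈ B ∧ s e ≠ t e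
  have hF : ∀ S : Finset V, x ∈ S → y ∉ S → 2 ≤ (cut s t S ∩ F).card := by
    intro S hxS hyS
    by_contra hlt
    have key : (dW (B ∩ S)).card + (dW (B \ S)).card ≤ 2 * (cut s t S ∩ F).card + (dW B).card := by
      have hF' : cut s t S ∩ F = Finset.univ.filter (fun e => ¬ (s e ∈ S ↔ t e ∈ S) ∧ s e ∈ B ∧ t e ∈ B) := by
        ext e
        simp only [cut, F, Finset.mem_inter, Finset.mem_filter, Finset.mem_univ, true_and]
        constructor
        · tauto
        · rintro ⟨h1, h2, h3⟩
          refine ⟨h1, h2, h3, fun h => h1 (by rw [h])⟩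
      rw [hF']
      simp only [dW, Finset.card_filter]
      rw [Finset.mul_sum, ← Finset.sum_add_distrib, ← Finset.sum_add_distrib]
      refine Finset.sum_le_sum fun e _ => ?_
      simp only [Finset.mem_inter, Finset.mem_sdiff]
      by_cases a1 : s e ∈ B <;> by_cases a2 : t e ∈ B <;> by_cases a3 : s e ∈ S <;>
        by_cases a4 : t e ∈ S <;> by_cases a5 : s e = r <;> by_cases a6 : t e = r <;>
        simp [a1, a2, a3, a4, a5, a6]
    have hb1 : ¬ Q (B ∩ S) := by
      intro hQ
      have h1 := hmin' _ hQ
      have h2 : B ∩ S ⊂ B := by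
        refine Finset.ssubset_iff_subset_ne.2 ⟨Finset.inter_subset_left, fun h => ?_⟩
        rw [← h] at hyB
        exact hyS (Finset.mem_inter.1 hyB).2
      have := Finset.card_lt_card h2
      omega
    have hb2 : ¬ Q (B \ S) := by
      intro hQ
      have h1 := hmin' _ hQ
      have h2 : B \ S ⊂ B := by
        refine Finset.ssubset_iff_subset_ne.2 ⟨Finset.sdiff_subset, fun h => ?_⟩
        rw [← h] at hxB
        exact (Finset.mem_sdiff.1 hxB).2 hxS
      have := Finset.card_lt_card h2
      omega
    have hc1 : 2 ≤ (dW (B ∩ S)).card := by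
      by_contra hc
      refine hb1 ⟨by simp [hrB], ⟨e1, ?_⟩, by omega⟩
      simp only [cut, Finset.mem_filter, Finset.mem_univ, true_and, Finset.mem_inter]
      rcases hx with ⟨hx1, hx2⟩ | ⟨hx1, hx2⟩ <;> rw [hx1, hx2] <;> simp [hxB, hxS, hrB]
    have hc2 : 2 ≤ (dW (B \ S)).card := by
      by_contra hc
      refine hb2 ⟨by simp [hrB], ⟨e2, ?_⟩, by omega⟩
      simp only [cut, Finset.mem_filter, Finset.mem_univ, true_and, Finset.mem_sdiff]
      rcases hy with ⟨hx1, hx2⟩ | ⟨hx1, hx2⟩ <;> rw [hx1, hx2] <;> simp [hyB, hyS, hrB]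
    omega
  obtain ⟨f, hf, hfb⟩ := twoflow s t F x y hF
  have hfF : ∀ e, f e ≠ 0 → e ∈ F := by
    intro e he
    by_contra h
    have := hf e
    simp [h] at this
    omega
  let A : Finset V := Finset.univ.filter fun a => ∃ h : E → ZMod 3, (∀ e, f e = 0 → h e = 0) ∧
        ∀ v, bd s t h v = (if a = v then 1 else 0) - (if x = v then 1 else 0)
  have hxA : x ∈ A := by
    simp only [A, Finset.mem_filter, Finset.mem_univ, true_and]
    exact ⟨fun _ => 0, by simp, by simp [bd]⟩
  have hcl : ∀ e, f e ≠ 0 → (s e ∈ A ↔ t e ∈ A) := by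
    intro e he
    simp only [A, Finset.mem_filter, Finset.mem_univ, true_and]
    constructor
    · rintro ⟨h, h1, h2⟩
      refine ⟨fun e' => h e' + (if e' = e then 1 else 0), fun e' he' => ?_, fun v => ?_⟩
      · have : e' ≠ e := by rintro rfl; exact he he'
        simp [h1 e' he', this]
      · rw [bd_add, bd_single, h2]; ring
    · rintro ⟨h, h1, h2⟩
      refine ⟨fun e' => h e' - (if e' = e then 1 else 0), fun e' he' => ?_, fun v => ?_⟩
      · have : e' ≠ e := by rintro rfl; exact he he'
        simp [h1 e' he', this]
      · rw [bd_sub, bd_single, h2]; ring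
  have hAB : ∀ a ∈ A, a ∈ B := by
    intro a ha
    by_contra haB
    simp only [A, Finset.mem_filter, Finset.mem_univ, true_and] at ha
    obtain ⟨h, h1, h2⟩ := ha
    have h3 := h2 a
    have hxa : x ≠ a := by rintro rfl; exact haB hxB
    rw [bd_zero_of] at h3
    · simp [hxa] at h3
    · intro e he
      have : f e ≠ 0 := fun h => he (h1 e h)
      have := hfF e this
      simp only [F, Finset.mem_filter, Finset.mem_univ, true_and] at this
      exact ⟨fun h => haB (h ▸ this.1), fun h => haB (h ▸ this.2.1)⟩
  have hyA : y ∈ A := by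
    by_contra hyA
    have h4 := sum_bd s t f A
    have h5 : ∑ v ∈ A, bd s t f v = -2 := by
      simp only [hfb]
      rw [← Finset.mul_sum, Finset.sum_sub_distrib]
      simp [hxA, hyA]
    rw [h5, Finset.sum_eq_zero] at h4
    · omega
    · intro e _
      by_cases he : f e = 0
      · simp [he]
      · simp [hcl e he]
  let D : Finset E := Finset.univ.filter fun e => f e ≠ 0 ∧ s e ∈ A
  refine ⟨A, x, y, e1, e2, D, fun h => hrB (hAB r h), hxA, hyA, hne, hx, hy, ?_, ?_, ?_⟩
  · intro e he
    simp only [D, Finset.mem_filter, Finset.mem_univ, true_and] at he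
    have := hfF e he.1
    simp only [F, Finset.mem_filter, Finset.mem_univ, true_and] at this
    exact ⟨he.2, (hcl e he.1).1 he.2, this.2.2⟩
  · intro v
    have h6 : (fun e => if e ∈ D then (1 : ZMod 2) else 0)
        = fun e => if s e ∈ A then ((f e : ℤ) : ZMod 2) else 0 := by
      funext e
      simp only [D, Finset.mem_filter, Finset.mem_univ, true_and]
      have h7 : f e = -1 ∨ f e = 0 ∨ f e = 1 := by
        have := hf e
        split_ifs at this <;> omega
      by_cases hs : s e ∈ A
      · rcases h7 with h | h | h <;> simp [h, hs]
      · simp [hs]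
    rw [h6, bd_restrict, bd_cast, hfb]
    · split_ifs <;> simp <;> decide
    · intro e he
      apply hcl
      rintro h
      simp [h] at he
  · intro a ha
    have ha' := ha
    simp only [A, Finset.mem_filter, Finset.mem_univ, true_and] at ha'
    obtain ⟨h, h1, h2⟩ := ha'
    refine ⟨fun e => if s e ∈ A then h e else 0, fun e he => ?_, fun v => ?_⟩
    · simp only [D, Finset.mem_filter, Finset.mem_univ, true_and] at he
      dsimp only
      split_ifs with hs
      · by_contra hc
        exact he ⟨fun h => hc (h1 e h), hs⟩
      · rfl
    · rw [bd_restrict]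
      · split_ifs with hv h3 h4 <;> first | (rw [h2]; simp [*]; done) | skip
        all_goals simp_all
      · intro e he
        exact hcl e fun h => he (h1 e h)

lemma cut_comp (s t : E → V) (φ : V → V) (S : Finset V) :
    cut (fun e => φ (s e)) (fun e => φ (t e)) S = cut s t (Finset.univ.filter fun v => φ v ∈ S) := by
  ext e; simp [cut]

lemma good_of_three (n : ℕ) : ∀ (s t : E → V), (nonloops s t).card = n →
    (∀ S : Finset V, cut s t S = ∅ ∨ 3 ≤ (cut s t S).card) → ∀ r, Good s t r := by
  induction n using Nat.strong_induction_on with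
  | _ n ih =>
  intro s t hn hcut
  have main : ∀ r, (∃ e, s e ≠ t e ∧ (s e = r ∨ t e = r)) → Good s t r := by
    intro r hr
    obtain ⟨A, x, y, e1, e2, D, hrA, hx, hy, hne, he1, he2, hD, hDe, hconn⟩ := exists_data s t hcut r hr
    refine good_ext s t r A hrA x y hx hy e1 e2 hne he1 he2 D hD hDe hconn ?_
    refine ih _ ?_ _ _ rfl ?_ r
    · rw [← hn]
      apply Finset.card_lt_card
      rw [Finset.ssubset_iff_of_subset]
      · refine ⟨e1, ?_, ?_⟩
        · simp only [nonloops, Finset.mem_filter, Finset.mem_univ, true_and]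
          rcases he1 with ⟨h1, h2⟩ | ⟨h1, h2⟩ <;> rw [h1, h2] <;> rintro rfl <;> exact hrA hx
        · simp only [nonloops, Finset.mem_filter, Finset.mem_univ, true_and, not_not]
          rcases he1 with ⟨h1, h2⟩ | ⟨h1, h2⟩ <;> rw [h1, h2] <;> simp [hx]
      · intro e
        simp only [nonloops, Finset.mem_filter, Finset.mem_univ, true_and]
        intro h h'
        exact h (by rw [h'])
    · intro S
      rw [cut_comp s t (fun v => if v ∈ A then r else v)]
      exact hcut _
  intro r
  by_cases hr : ∃ e, s e ≠ t e ∧ (s e = r ∨ t e = r)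
  · exact main r hr
  · push Not at hr
    by_cases hl : ∃ e, s e ≠ t e
    · obtain ⟨e, he⟩ := hl
      obtain ⟨c, ψ, h1, h2, h3, h4⟩ := main (s e) ⟨e, he, Or.inl rfl⟩
      refine ⟨c, ψ, h1, h2, fun e' he' => ?_, h4⟩
      have := h3 e' he'
      have h5 := hr e' this.2.2
      exact ⟨h5.1, h5.2, this.2.2⟩
    · push Not at hl
      refine ⟨fun _ => 0, fun _ => 1, ?_, ?_, by simp, by simp⟩
      · intro v; simp [bd]
      · intro v; simp [bd, hl]

lemma lift_one {M : Type} [AddCommGroup M] (s t : E → V) (e : E) (he : s e ≠ t e) (f : E → M)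
    (hf : ∀ v, bd (fun e' => if s e' = s e then t e else s e')
      (fun e' => if t e' = s e then t e else t e') f v = 0) :
    ∀ v, bd s t (fun e' => f e' + if e' = e then bd s t f (s e) else 0) v = 0 := by
  intro v
  have hcomp := fun w => bd_comp s t (fun v => if v = s e then t e else v) f w
  rw [bd_add, bd_single]
  by_cases h1 : v = s e
  · subst h1; simp [he.symm]
  · by_cases h2 : v = t e
    · subst h2
      have h3 := hcomp (t e)
      rw [hf] at h3
      have : Finset.univ.filter (fun v => (if v = s e then t e else v) = t e) = {s e, t e} := by
        ext v; simp; tauto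
      rw [this, Finset.sum_pair he] at h3
      simp [he, add_comm, ← h3]
    · have h3 := hcomp v
      rw [hf] at h3
      have : Finset.univ.filter (fun w => (if w = s e then t e else w) = v) = {v} := by
        ext w; simp; split_ifs with h
        · constructor
          · intro h'; exact absurd h'.symm h2
          · rintro rfl; exact absurd h h1
        · rfl
      rw [this, Finset.sum_singleton] at h3
      simp [← h3, Ne.symm h1, Ne.symm h2]

lemma cut_two {M : Type} [AddCommGroup M] (s t : E → V) (S : Finset V) (e e' : E) (hne : e ≠ e')
    (hS : cut s t S = {e, e'}) (f : E → M) (hf : ∀ v, bd s t f v = 0) (h : f e = 0) : f e' = 0 := by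
  have h1 := sum_bd s t f S
  rw [Finset.sum_eq_zero (fun v _ => hf v)] at h1
  have hmem : ∀ a, ¬ (s a ∈ S ↔ t a ∈ S) ↔ a = e ∨ a = e' := by
    intro a
    have : a ∈ cut s t S ↔ a ∈ ({e, e'} : Finset E) := by rw [hS]
    simpa [cut] using this
  rw [Finset.sum_eq_single e'] at h1
  · have := (hmem e').2 (Or.inr rfl)
    by_cases hs : s e' ∈ S <;> by_cases ht : t e' ∈ S <;> simp [hs, ht] at h1 this <;> simp [h1]
  · intro b _ hb
    by_cases hbe : b = e
    · subst hbe; simp [h]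
    · have : s b ∈ S ↔ t b ∈ S := by
        by_contra hc
        rcases (hmem b).1 hc with h | h
        · exact hbe h
        · exact hb h
      simp [this]
  · simp

lemma six_flow (n : ℕ) : ∀ (s t : E → V), (nonloops s t).card = n →
    (∀ S : Finset V, (cut s t S).card ≠ 1) →
    ∃ (c : E → ZMod 2) (ψ : E → ZMod 3), (∀ v, bd s t c v = 0) ∧ (∀ v, bd s t ψ v = 0) ∧
      ∀ e, c e ≠ 0 ∨ ψ e ≠ 0 := by
  induction n using Nat.strong_induction_on with
  | _ n ih =>
  intro s t hn hcut
  by_cases h2 : ∃ S : Finset V, (cut s t S).card = 2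
  · obtain ⟨S, hS⟩ := h2
    obtain ⟨e, e', hne, hS⟩ := Finset.card_eq_two.1 hS
    have he : s e ≠ t e := by
      intro h
      have : e ∈ cut s t S := by rw [hS]; simp
      simp [cut, h] at this
    obtain ⟨c, ψ, hc, hψ, hcov⟩ := ih (nonloops (fun e' => if s e' = s e then t e else s e')
      (fun e' => if t e' = s e then t e else t e')).card (by
        rw [← hn]
        apply Finset.card_lt_card
        rw [Finset.ssubset_iff_of_subset]
        · exact ⟨e, by simp [nonloops, he], by simp [nonloops]⟩
        · intro e
          simp only [nonloops, Finset.mem_filter, Finset.mem_univ, true_and]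
          intro h h'
          exact h (by rw [h'])) _ _ rfl (by
        intro S
        rw [cut_comp s t (fun v => if v = s e then t e else v)]
        exact hcut _)
    have hc2 := lift_one s t e he c hc
    have hψ2 := lift_one s t e he ψ hψ
    refine ⟨_, _, hc2, hψ2, fun a => ?_⟩
    by_cases ha : a = e
    · subst ha
      by_contra hcon
      rw [not_or, not_not, not_not] at hcon
      have k1 := cut_two s t S a e' hne hS _ hc2 hcon.1
      have k2 := cut_two s t S a e' hne hS _ hψ2 hcon.2
      simp only [hne.symm, if_false, add_zero] at k1 k2
      rcases hcov e' with h | h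
      · exact h k1
      · exact h k2
    · simpa [ha] using hcov a
  · push Not at h2
    by_cases hV : Nonempty V
    · obtain ⟨r⟩ := hV
      obtain ⟨c, ψ, a, b, _, d⟩ := good_of_three n s t hn (fun S => by
        have h3 := hcut S
        have h4 := h2 S
        rcases Nat.eq_zero_or_pos (cut s t S).card with h | h
        · left; exact Finset.card_eq_zero.1 h
        · right; omega) r
      exact ⟨c, ψ, a, b, d⟩
    · refine ⟨fun _ => 0, fun _ => 0, fun v => absurd ⟨v⟩ hV, fun v => absurd ⟨v⟩ hV, fun e => absurd ⟨s e⟩ hV⟩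

end Six

section Decomp

set_option linter.unusedSectionVars false

lemma degree_eq (ends : E → Sym2 V) (s t : E → V) (hst : ∀ e, ends e = s(s e, t e)) (F : Finset E) (v : V) :
    degree ends F v = ∑ e ∈ F, ((if s e = v then 1 else 0) + (if t e = v then 1 else 0)) := by
  unfold degree
  refine Finset.sum_congr rfl fun e _ => ?_
  rw [hst e]
  by_cases h1 : s e = v <;> by_cases h2 : t e = v
  · simp [h1, h2, Sym2.diag]
  · simp [h1, h2, Sym2.diag, Ne.symm h2]
  · simp [h1, h2, Sym2.diag, Ne.symm h1]
  · simp [h1, h2, Sym2.diag, Ne.symm h1, Ne.symm h2]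

lemma sum_degree (ends : E → Sym2 V) (s t : E → V) (hst : ∀ e, ends e = s(s e, t e)) (F : Finset E) :
    ∑ v, degree ends F v = 2 * F.card := by
  simp only [degree_eq ends s t hst]
  rw [Finset.sum_comm]
  simp [Finset.sum_add_distrib]
  ring

lemma degree_bd (ends : E → Sym2 V) (s t : E → V) (hst : ∀ e, ends e = s(s e, t e)) (c : E → ZMod 2) (v : V) :
    ((degree ends (Finset.univ.filter fun e => c e ≠ 0) v : ℕ) : ZMod 2) = bd s t c v := by
  rw [degree_eq ends s t hst, bd, Finset.sum_filter]
  push_cast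
  refine Finset.sum_congr rfl fun e _ => ?_
  generalize c e = z
  revert z
  by_cases h1 : s e = v <;> by_cases h2 : t e = v <;> simp only [h1, h2, if_true, if_false] <;> decide

def EvenOn (ends : E → Sym2 V) (F : Finset E) : Prop := ∀ v, Even (degree ends F v)

lemma evenOn_iff (ends : E → Sym2 V) (s t : E → V) (hst : ∀ e, ends e = s(s e, t e)) (F : Finset E) :
    EvenOn ends F ↔ ∀ v, bd s t (fun e => if e ∈ F then (1 : ZMod 2) else 0) v = 0 := by
  refine forall_congr' fun v => ?_
  rw [← degree_bd ends s t hst, ZMod.natCast_eq_zero_iff_even]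
  have : (Finset.univ.filter fun e => (if e ∈ F then (1 : ZMod 2) else 0) ≠ 0) = F := by
    ext e; simp
  rw [this]

lemma degree_pos_iff (ends : E → Sym2 V) (F : Finset E) (v : V) :
    v ∈ support ends F ↔ degree ends F v ≠ 0 := by
  unfold support degree
  simp only [Finset.mem_filter, Finset.mem_univ, true_and, ne_eq, Finset.sum_eq_zero_iff, not_forall]
  refine exists_congr fun e => ?_
  by_cases h : e ∈ F
  · simp only [h, true_and, exists_true_left]
    by_cases h1 : ends e = Sym2.diag v
    · simp [h1, Sym2.diag]
    · simp [h1]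
  · simp [h]

/-- A minimal nonempty even set is a circuit. -/
lemma circuit_of_minimal (ends : E → Sym2 V) (s t : E → V) (hst : ∀ e, ends e = s(s e, t e))
    (C : Finset E) (hne : C.Nonempty) (hev : EvenOn ends C)
    (hmin : ∀ X ⊆ C, X.Nonempty → EvenOn ends X → X = C) : IsCircuit ends C := by
  obtain ⟨e0, he0⟩ := hne
  refine ⟨⟨e0, he0⟩, ?_, ?_⟩
  · intro u hu v hv
    let A : Finset V := Finset.univ.filter fun w => Reach ends C u w
    have hA : ∀ w, w ∈ A ↔ Reach ends C u w := by intro w; simp [A]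
    have hcl : ∀ e ∈ C, (s e ∈ A ↔ t e ∈ A) := by
      intro e he
      rw [hA, hA]
      constructor
      · intro h
        exact Relation.ReflTransGen.tail h ⟨e, he, hst e⟩
      · intro h
        exact Relation.ReflTransGen.tail h ⟨e, he, by rw [hst e, Sym2.eq_swap]⟩
    have huA : u ∈ A := (hA u).2 Relation.ReflTransGen.refl
    have hX : EvenOn ends (C.filter fun e => s e ∈ A) := by
      rw [evenOn_iff ends s t hst] at hev ⊢
      intro v
      have h1 := bd_restrict s t (fun e => if e ∈ C then (1 : ZMod 2) else 0) A
        (by intro e he; apply hcl; by_contra h; simp [h] at he) v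
      rw [hev, ite_self] at h1
      have h2 : (fun e => if e ∈ C.filter (fun e => s e ∈ A) then (1 : ZMod 2) else 0)
          = fun e => if s e ∈ A then (if e ∈ C then (1 : ZMod 2) else 0) else 0 := by
        funext e
        by_cases a : e ∈ C <;> by_cases b : s e ∈ A <;> simp [a, b]
      rw [h2]
      exact h1
    have hXne : (C.filter fun e => s e ∈ A).Nonempty := by
      simp only [support, Finset.mem_filter, Finset.mem_univ, true_and] at hu
      obtain ⟨e, he, hue⟩ := hu
      refine ⟨e, ?_⟩
      rw [hst e, Sym2.mem_iff] at hue
      rw [Finset.mem_filter]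
      refine ⟨he, ?_⟩
      rcases hue with h | h
      · rw [← h]; exact huA
      · rw [hcl e he, ← h]; exact huA
    have hXC := hmin _ (Finset.filter_subset _ _) hXne hX
    simp only [support, Finset.mem_filter, Finset.mem_univ, true_and] at hv
    obtain ⟨e, he, hve⟩ := hv
    rw [hst e, Sym2.mem_iff] at hve
    have hs : s e ∈ A := by
      rw [← hXC] at he
      exact (Finset.mem_filter.1 he).2
    rw [← hA]
    rcases hve with h | h
    · rw [h]; exact hs
    · rw [h, ← hcl e he]; exact hs
  · -- counting
    let S := support ends C
    have hsS : s e0 ∈ S := by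
      simp only [S, support, Finset.mem_filter, Finset.mem_univ, true_and]
      exact ⟨e0, he0, by rw [hst]; simp⟩
    let ind : Finset E → E → ZMod 2 := fun X e => if e ∈ X then 1 else 0
    have hcard : C.card ≤ S.card := by
      -- injection from subsets of C \ e0 into subsets of S \ (s e0)
      let T : Finset E → Finset V := fun X => Finset.univ.filter fun v => bd s t (ind X) v ≠ 0 ∧ v ≠ s e0
      have hmaps : ∀ X ∈ (C.erase e0).powerset, T X ∈ (S.erase (s e0)).powerset := by
        intro X hX
        rw [Finset.mem_powerset] at hX ⊢
        intro v hv
        simp only [T, Finset.mem_filter, Finset.mem_univ, true_and] at hv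
        rw [Finset.mem_erase]
        refine ⟨hv.2, ?_⟩
        by_contra hvS
        apply hv.1
        refine bd_zero_of _ _ _ _ fun e he => ?_
        have heX : e ∈ X := by by_contra h; simp [ind, h] at he
        have heC := Finset.mem_of_mem_erase (hX heX)
        simp only [S, support, Finset.mem_filter, Finset.mem_univ, true_and, not_exists, not_and] at hvS
        have := hvS e heC
        rw [hst, Sym2.mem_iff] at this
        push Not at this
        exact ⟨this.1.symm, this.2.symm⟩
      have hinj : Set.InjOn T ((C.erase e0).powerset : Set (Finset E)) := by
        intro X hX Y hY hXY
        simp only [Finset.mem_coe, Finset.mem_powerset] at hX hY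
        have hz2 : ∀ a b : ZMod 2, (a ≠ 0 ↔ b ≠ 0) → a = b := by decide
        have hind : ind (symmDiff X Y) = fun e => ind X e - ind Y e := by
          funext e
          simp only [ind, Finset.mem_symmDiff]
          by_cases a : e ∈ X <;> by_cases b : e ∈ Y <;> simp [a, b]
        have h1 : ∀ v, v ≠ s e0 → bd s t (ind (symmDiff X Y)) v = 0 := by
          intro v hv
          rw [hind, bd_sub, sub_eq_zero]
          apply hz2
          have : v ∈ T X ↔ v ∈ T Y := by rw [hXY]
          simpa [T, hv] using this
        have h2 : EvenOn ends (symmDiff X Y) := by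
          rw [evenOn_iff ends s t hst]
          intro v
          by_cases hv : v = s e0
          · have h3 := sum_bd_univ s t (ind (symmDiff X Y))
            rw [Finset.sum_eq_single (s e0) (fun b _ hb => h1 b hb) (by simp)] at h3
            rw [hv]; exact h3
          · exact h1 v hv
        have h4 : symmDiff X Y ⊆ C.erase e0 := by
          intro e he
          rw [Finset.mem_symmDiff] at he
          rcases he with he | he
          · exact hX he.1
          · exact hY he.1
        by_contra hne
        have h5 : (symmDiff X Y).Nonempty := by
          rw [Finset.nonempty_iff_ne_empty]
          intro h
          exact hne (symmDiff_eq_bot.1 h)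
        have h6 := hmin _ (h4.trans (Finset.erase_subset _ _)) h5 h2
        rw [h6] at h4
        exact absurd (h4 he0) (by simp)
      have h7 := Finset.card_le_card_of_injOn T hmaps hinj
      rw [Finset.card_powerset, Finset.card_powerset, Nat.pow_le_pow_iff_right (by norm_num),
        Finset.card_erase_of_mem he0, Finset.card_erase_of_mem hsS] at h7
      have := Finset.card_pos.2 ⟨e0, he0⟩
      have := Finset.card_pos.2 ⟨_, hsS⟩
      omega
    have hsum := sum_degree ends s t hst C
    have hge : ∀ v ∈ S, 2 ≤ degree ends C v := by
      intro v hv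
      have h1 := (degree_pos_iff ends C v).1 hv
      obtain ⟨k, hk⟩ := hev v
      omega
    have hsumS : ∑ v ∈ S, degree ends C v = 2 * C.card := by
      rw [← hsum]
      refine Finset.sum_subset (Finset.subset_univ _) fun v _ hv => ?_
      by_contra h
      exact hv ((degree_pos_iff ends C v).2 h)
    intro v hv
    by_contra hd
    have hlt : ∑ v ∈ S, 2 < ∑ v ∈ S, degree ends C v :=
      Finset.sum_lt_sum hge ⟨v, hv, lt_of_le_of_ne (hge v hv) (Ne.symm hd)⟩
    rw [hsumS] at hlt
    simp at hlt
    omega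

lemma decomp (ends : E → Sym2 V) (s t : E → V) (hst : ∀ e, ends e = s(s e, t e)) (n : ℕ) :
    ∀ F : Finset E, F.card = n → EvenOn ends F →
    ∃ L : List (Finset E), (∀ C ∈ L, IsCircuit ends C) ∧ (∀ e ∈ F, ∃ C ∈ L, e ∈ C) ∧
      totalLength L = F.card := by
  induction n using Nat.strong_induction_on with
  | _ n ih =>
  intro F hn hF
  by_cases hne : F.Nonempty
  · obtain ⟨C, hC, hmin⟩ := Finset.exists_min_image
      (Finset.univ.filter fun X : Finset E => X ⊆ F ∧ X.Nonempty ∧ EvenOn ends X) Finset.card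
      ⟨F, by simp [hne, hF]⟩
    simp only [Finset.mem_filter, Finset.mem_univ, true_and] at hC hmin
    obtain ⟨hCF, hCne, hCev⟩ := hC
    have hcirc := circuit_of_minimal ends s t hst C hCne hCev (fun X hX hXne hXev =>
      Finset.eq_of_subset_of_card_le hX (hmin X ⟨hX.trans hCF, hXne, hXev⟩))
    have hdiff : EvenOn ends (F \ C) := by
      rw [evenOn_iff ends s t hst] at hF hCev ⊢
      intro v
      have : (fun e => if e ∈ F \ C then (1 : ZMod 2) else 0)
          = fun e => (if e ∈ F then (1 : ZMod 2) else 0) - (if e ∈ C then (1 : ZMod 2) else 0) := by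
        funext e
        by_cases a : e ∈ C
        · simp [a, hCF a]
        · simp [a]
      rw [this, bd_sub, hF, hCev, sub_zero]
    have hcard := Finset.card_sdiff_add_card_eq_card hCF
    have hpos := Finset.card_pos.2 hCne
    obtain ⟨L, h1, h2, h3⟩ := ih (F \ C).card (by omega) (F \ C) rfl hdiff
    refine ⟨C :: L, ?_, ?_, ?_⟩
    · intro X hX
      rcases List.mem_cons.1 hX with rfl | hX
      · exact hcirc
      · exact h1 X hX
    · intro e he
      by_cases heC : e ∈ C
      · exact ⟨C, by simp, heC⟩
      · obtain ⟨X, hX, heX⟩ := h2 e (by simp [he, heC])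
        exact ⟨X, by simp [hX], heX⟩
    · simp only [totalLength, List.map_cons, List.sum_cons] at h3 ⊢
      omega
  · rw [Finset.not_nonempty_iff_eq_empty] at hne
    subst hne
    exact ⟨[], by simp, by simp, by simp [totalLength]⟩

lemma decomp_flow (ends : E → Sym2 V) (s t : E → V) (hst : ∀ e, ends e = s(s e, t e))
    (c : E → ZMod 2) (hc : ∀ v, bd s t c v = 0) :
    ∃ L : List (Finset E), (∀ C ∈ L, IsCircuit ends C) ∧ (∀ e, c e ≠ 0 → ∃ C ∈ L, e ∈ C) ∧
      totalLength L = ∑ e, (if c e ≠ 0 then 1 else 0) := by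
  obtain ⟨L, h1, h2, h3⟩ := decomp ends s t hst _ (Finset.univ.filter fun e => c e ≠ 0) rfl (by
    intro v
    rw [← ZMod.natCast_eq_zero_iff_even, degree_bd ends s t hst, hc])
  refine ⟨L, h1, fun e he => h2 e (by simpa using he), ?_⟩
  rw [h3, Finset.card_filter]

lemma reach_mem (ends : E → Sym2 V) (s t : E → V) (hst : ∀ e, ends e = s(s e, t e)) (F : Finset E)
    (S : Finset V) (hF : ∀ e ∈ F, (s e ∈ S ↔ t e ∈ S)) (a b : V) (h : Reach ends F a b) :
    a ∈ S ↔ b ∈ S := by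
  induction h with
  | refl => rfl
  | tail _ h ih =>
    obtain ⟨e, he, hab⟩ := h
    rw [ih]
    have := hF e he
    rw [hst e, Sym2.eq_iff] at hab
    rcases hab with ⟨h1, h2⟩ | ⟨h1, h2⟩
    · rw [← h1, ← h2, this]
    · rw [← h1, ← h2, this]

lemma cut_ne_one (ends : E → Sym2 V) (s t : E → V) (hst : ∀ e, ends e = s(s e, t e))
    (hb : ∀ e : E, ¬ IsBridgeIn ends Finset.univ e) (S : Finset V) : (cut s t S).card ≠ 1 := by
  intro h
  obtain ⟨e, he⟩ := Finset.card_eq_one.1 h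
  apply hb e
  refine ⟨by simp, fun a b hab hreach => ?_⟩
  have h1 := reach_mem ends s t hst _ S (by
    intro e' he'
    by_contra hc
    have : e' ∈ cut s t S := by simpa [cut] using hc
    rw [he] at this
    simp at this
    simp [this] at he') a b hreach
  have h2 : e ∈ cut s t S := by rw [he]; simp
  simp only [cut, Finset.mem_filter, Finset.mem_univ, true_and] at h2
  rw [hst e, Sym2.eq_iff] at hab
  rcases hab with ⟨h3, h4⟩ | ⟨h3, h4⟩
  · rw [h3, h4] at h2; exact h2 h1
  · rw [h3, h4] at h2; exact h2 h1.symm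

/-- A `ZMod 3` flow gives two `ZMod 2` flows with the same total support. -/
lemma three_to_four (s t : E → V) (ψ : E → ZMod 3) (hψ : ∀ v, bd s t ψ v = 0) :
    ∃ d1 d2 : E → ZMod 2, (∀ v, bd s t d1 v = 0) ∧ (∀ v, bd s t d2 v = 0) ∧
      ∀ e, ψ e ≠ 0 ↔ (d1 e ≠ 0 ∨ d2 e ≠ 0) := by
  obtain ⟨g, g1, g2, g3⟩ := exists_int_flow s t 3 (by norm_num) ψ hψ
  have hp : ∀ v, bd s t (fun e => ((g e : ℤ) : ZMod 2)) v = 0 := by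
    intro v; rw [bd_cast, g3]; simp
  obtain ⟨w, w1, w2, w3⟩ := exists_int_flow s t 2 (by norm_num) _ hp
  have hdvd : ∀ e, ∃ q, g e + w e = 2 * q := by
    intro e
    have := w1 e
    rw [ZMod.intCast_eq_intCast_iff_dvd_sub] at this
    obtain ⟨q, hq⟩ := this
    push_cast at hq
    exact ⟨w e + q, by linarith⟩
  choose q hq using hdvd
  have hqb : ∀ v, bd s t q v = 0 := by
    intro v
    have h1 := bd_mul s t (2 : ℤ) q v
    have h2 : (fun e => 2 * q e) = fun e => g e + w e := by funext e; rw [hq]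
    rw [h2, bd_add, g3, w3] at h1
    omega
  refine ⟨fun e => ((g e : ℤ) : ZMod 2), fun e => ((q e : ℤ) : ZMod 2), hp, ?_, ?_⟩
  · intro v; rw [bd_cast, hqb]; simp
  · intro e
    rw [← g1 e]
    have a := abs_lt.1 (g2 e)
    have b := abs_lt.1 (w2 e)
    have c := hq e
    push_cast at a b
    simp only [ne_eq, ZMod.intCast_zmod_eq_zero_iff_dvd]
    push_cast
    omega

lemma z3_pt : ∀ p h : ZMod 3, (if p ≠ 0 then 1 else 0) + (if p + h ≠ 0 then 1 else 0)
    + (if p - h ≠ 0 then 1 else 0) + (if h ≠ 0 then 1 else 0) ≤ 3 := by decide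

lemma z2_pt : ∀ c a b : ZMod 2,
    (if c ≠ 0 then 1 else 0) + (if c + a ≠ 0 then 1 else 0) + (if c + b ≠ 0 then 1 else 0)
      + (if c + (a + b) ≠ 0 then 1 else 0) + (if a ≠ 0 ∨ b ≠ 0 then 2 else 0) ≤ 4 := by decide

lemma z2_pt2 : ∀ a b : ZMod 2,
    (if a ≠ 0 then 1 else 0) + (if b ≠ 0 then 1 else 0) + (if a + b ≠ 0 then 1 else 0)
      = (if a ≠ 0 ∨ b ≠ 0 then 2 else 0) := by decide

lemma cover_aux (s t : E → V) (hcut : ∀ S : Finset V, (cut s t S).card ≠ 1) :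
    ∃ c a b : E → ZMod 2, (∀ v, bd s t c v = 0) ∧ (∀ v, bd s t a v = 0) ∧ (∀ v, bd s t b v = 0) ∧
      (∀ e, c e ≠ 0 ∨ a e ≠ 0 ∨ b e ≠ 0) ∧
      3 * ((∑ e, (if c e ≠ 0 then 1 else 0)) + (∑ e, (if a e ≠ 0 then 1 else 0))
        + (∑ e, (if b e ≠ 0 then 1 else 0))) ≤ 5 * Fintype.card E := by
  let Q : (E → ZMod 2) × (E → ZMod 3) → Prop := fun p =>
    (∀ v, bd s t p.1 v = 0) ∧ (∀ v, bd s t p.2 v = 0) ∧ ∀ e, p.1 e ≠ 0 ∨ p.2 e ≠ 0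
  let n2 : (E → ZMod 2) → ℕ := fun c => ∑ e, (if c e ≠ 0 then 1 else 0)
  let n3 : (E → ZMod 3) → ℕ := fun c => ∑ e, (if c e ≠ 0 then 1 else 0)
  obtain ⟨c0, ψ0, h1, h2, h3⟩ := six_flow _ s t rfl hcut
  obtain ⟨⟨c, ψ⟩, hQ, hmin⟩ := Finset.exists_min_image (Finset.univ.filter Q)
    (fun p => 3 * n2 p.1 + 4 * n3 p.2) ⟨(c0, ψ0), by simpa [Q] using ⟨h1, h2, h3⟩⟩
  obtain ⟨hc, hψ, hcov⟩ : Q (c, ψ) := by simpa using hQ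
  have hmin' : ∀ c' ψ', Q (c', ψ') → 3 * n2 c + 4 * n3 ψ ≤ 3 * n2 c' + 4 * n3 ψ' :=
    fun c' ψ' h => hmin (c', ψ') (by simpa using h)
  dsimp only at hc hψ hcov
  -- first inequality
  have hA : 3 * n3 ψ + n2 c ≤ 3 * Fintype.card E := by
    obtain ⟨w, w1, w2, w3⟩ := exists_int_flow s t 2 (by norm_num) c hc
    let h : E → ZMod 3 := fun e => ((w e : ℤ) : ZMod 3)
    have hh : ∀ v, bd s t h v = 0 := by intro v; simp only [h]; rw [bd_cast, w3]; simp
    have hhc : ∀ e, c e ≠ 0 ↔ h e ≠ 0 := by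
      intro e
      have := abs_lt.1 (w2 e)
      push_cast at this
      simp only [h, ne_eq]
      rw [← w1 e, ZMod.intCast_zmod_eq_zero_iff_dvd, ZMod.intCast_zmod_eq_zero_iff_dvd]
      push_cast
      omega
    have q1 : Q (c, fun e => ψ e + h e) := by
      refine ⟨hc, fun v => ?_, fun e => ?_⟩
      · dsimp only; rw [bd_add, hψ, hh, add_zero]
      · dsimp only
        by_cases hce : c e = 0
        · right
          have := hcov e
          have h0 : h e = 0 := by by_contra hx; exact (hhc e).2 hx hce
          simpa [hce, h0] using this
        · exact Or.inl hce
    have q2 : Q (c, fun e => ψ e - h e) := by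
      refine ⟨hc, fun v => ?_, fun e => ?_⟩
      · dsimp only; rw [bd_sub, hψ, hh, sub_zero]
      · dsimp only
        by_cases hce : c e = 0
        · right
          have := hcov e
          have h0 : h e = 0 := by by_contra hx; exact (hhc e).2 hx hce
          simpa [hce, h0] using this
        · exact Or.inl hce
    have i1 := hmin' _ _ q1
    have i2 := hmin' _ _ q2
    have key : n3 ψ + n3 (fun e => ψ e + h e) + n3 (fun e => ψ e - h e) + n2 c ≤ 3 * Fintype.card E := by
      simp only [n3, n2, ← Finset.sum_add_distrib]
      refine (Finset.sum_le_card_nsmul _ _ 3 fun e _ => ?_).trans (by simp [mul_comm])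
      have := z3_pt (ψ e) (h e)
      simp only [hhc e]
      exact this
    omega
  obtain ⟨a, b, ha, hb, hab⟩ := three_to_four s t ψ hψ
  have hn3 : n3 ψ * 2 = ∑ e, (if a e ≠ 0 ∨ b e ≠ 0 then 2 else 0) := by
    simp only [n3]
    rw [Finset.sum_mul]
    refine Finset.sum_congr rfl fun e _ => ?_
    by_cases hx : ψ e ≠ 0
    · rw [if_pos hx, if_pos ((hab e).1 hx), one_mul]
    · rw [if_neg hx, if_neg (fun h => hx ((hab e).2 h)), zero_mul]
  have hQadd : ∀ d : E → ZMod 2, (∀ v, bd s t d v = 0) → (∀ e, a e = 0 → b e = 0 → d e = 0) →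
      Q (fun e => c e + d e, ψ) := by
    intro d hd hd0
    refine ⟨fun v => ?_, hψ, fun e => ?_⟩
    · dsimp only; rw [bd_add, hc, hd, add_zero]
    · dsimp only
      by_cases hx : ψ e = 0
      · left
        have h1 : ¬ (a e ≠ 0 ∨ b e ≠ 0) := fun h => (hab e).2 h hx
        push Not at h1
        have := hcov e
        simpa [hx, hd0 e h1.1 h1.2] using this
      · exact Or.inr hx
  have hadd : ∀ v, bd s t (fun e => a e + b e) v = 0 := by intro v; rw [bd_add, ha, hb, add_zero]
  have i1 := hmin' _ _ (hQadd a ha fun e h _ => h)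
  have i2 := hmin' _ _ (hQadd b hb fun e _ h => h)
  have i3 := hmin' _ _ (hQadd (fun e => a e + b e) hadd fun e h h' => by simp [h, h'])
  have key : n2 c + n2 (fun e => c e + a e) + n2 (fun e => c e + b e) + n2 (fun e => c e + (a e + b e))
      + n3 ψ * 2 ≤ 4 * Fintype.card E := by
    rw [hn3]
    simp only [n2, ← Finset.sum_add_distrib]
    refine (Finset.sum_le_card_nsmul _ _ 4 fun e _ => ?_).trans (by simp [mul_comm])
    exact z2_pt (c e) (a e) (b e)
  have key2 : n2 a + n2 b + n2 (fun e => a e + b e) = n3 ψ * 2 := by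
    rw [hn3]
    simp only [n2, ← Finset.sum_add_distrib]
    exact Finset.sum_congr rfl fun e _ => z2_pt2 (a e) (b e)
  have hfin : 3 * n2 c + 4 * n3 ψ ≤ 5 * Fintype.card E := by omega
  have hcov2 : ∀ e, c e ≠ 0 ∨ a e ≠ 0 ∨ b e ≠ 0 := fun e => (hcov e).imp_right (hab e).1
  have z1 : ∀ x y : ZMod 2, x ≠ 0 ∨ y ≠ 0 → x ≠ 0 ∨ x + y ≠ 0 := by decide
  have z2 : ∀ x y : ZMod 2, x ≠ 0 ∨ y ≠ 0 → y ≠ 0 ∨ x + y ≠ 0 := by decide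
  by_cases c1 : 3 * (n2 a + n2 b) ≤ 4 * n3 ψ
  · refine ⟨c, a, b, hc, ha, hb, hcov2, ?_⟩
    change 3 * (n2 c + n2 a + n2 b) ≤ _
    omega
  · by_cases c2 : 3 * (n2 a + n2 (fun e => a e + b e)) ≤ 4 * n3 ψ
    · refine ⟨c, a, fun e => a e + b e, hc, ha, hadd, fun e => (hcov2 e).imp_right (z1 _ _), ?_⟩
      change 3 * (n2 c + n2 a + n2 (fun e => a e + b e)) ≤ _
      omega
    · refine ⟨c, b, fun e => a e + b e, hc, hb, hadd, fun e => (hcov2 e).imp_right (z2 _ _), ?_⟩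
      change 3 * (n2 c + n2 b + n2 (fun e => a e + b e)) ≤ _
      omega

end Decomp

/-- Every bridgeless graph has a circuit cover of total length
at most 5/3 of the number of edges. -/
theorem statement0 {V E : Type} [Fintype V] [Fintype E] [DecidableEq V] [DecidableEq E]
    (ends : E → Sym2 V)
    (hbridgeless : ∀ e : E, ¬ IsBridgeIn ends Finset.univ e) :
    ∃ 𝒞 : List (Finset E),
      (∀ C ∈ 𝒞, IsCircuit ends C) ∧ CoversAll 𝒞 ∧
      3 * totalLength 𝒞 ≤ 5 * Fintype.card E := by
  have hex : ∀ e, ∃ p : V × V, ends e = s(p.1, p.2) := by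
    intro e
    induction ends e using Sym2.ind with
    | _ x y => exact ⟨(x, y), rfl⟩
  choose p hp using hex
  have hst : ∀ e, ends e = s((fun e => (p e).1) e, (fun e => (p e).2) e) := hp
  obtain ⟨c, a, b, hc, ha, hb, hcov, hlen⟩ := cover_aux (fun e => (p e).1) (fun e => (p e).2)
    (cut_ne_one ends _ _ hst hbridgeless)
  obtain ⟨L1, a1, b1, d1⟩ := decomp_flow ends _ _ hst c hc
  obtain ⟨L2, a2, b2, d2⟩ := decomp_flow ends _ _ hst a ha
  obtain ⟨L3, a3, b3, d3⟩ := decomp_flow ends _ _ hst b hb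
  refine ⟨L1 ++ L2 ++ L3, ?_, ?_, ?_⟩
  · intro C hC
    rw [List.mem_append, List.mem_append] at hC
    rcases hC with (h | h) | h
    · exact a1 C h
    · exact a2 C h
    · exact a3 C h
  · intro e
    rcases hcov e with h | h | h
    · obtain ⟨C, h1, h2⟩ := b1 e h
      exact ⟨C, by simp [h1], h2⟩
    · obtain ⟨C, h1, h2⟩ := b2 e h
      exact ⟨C, by simp [h1], h2⟩
    · obtain ⟨C, h1, h2⟩ := b3 e h
      exact ⟨C, by simp [h1], h2⟩
  · have : totalLength (L1 ++ L2 ++ L3) = totalLength L1 + totalLength L2 + totalLength L3 := by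
      simp [totalLength, add_assoc]
    rw [this, d1, d2, d3]
    exact hlen

end SignedCircuitCover
end
end

section
/- Let H be a tree of circuits with an even number of unbalanced circuits. Then H admits three weak signed circuit covers C1, C2, C3 of total width at most 4 such that C1 covers every negative loop of H exactly twice. -/
open Finset
open scoped Classical

noncomputable section

namespace SignedCircuitCover

variable {V E : Type} [Fintype V] [Fintype E] [DecidableEq V] [DecidableEq E]

section Helpers

set_option linter.unusedSectionVars false
set_option linter.unusedSimpArgs false

variable {ends : E → Sym2 V}

inductive Tr (ends : E → Sym2 V) : V → List E → V → Prop
  | nil (a : V) : Tr ends a [] a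
  | cons {a b c : V} {e : E} {l : List E} : ends e = s(a, b) → Tr ends b l c →
      Tr ends a (e :: l) c

inductive SP (ends : E → Sym2 V) : V → List E → V → Prop
  | nil (a : V) : SP ends a [] a
  | cons {a b c : V} {e : E} {l : List E} : ends e = s(a, b) → a ≠ b →
      (∀ g ∈ l, a ∉ ends g) → SP ends b l c → SP ends a (e :: l) c

lemma SP.tr {a b : V} {l : List E} (h : SP ends a l b) : Tr ends a l b := by
  induction h with
  | nil a => exact Tr.nil a
  | cons h1 _ _ _ ih => exact Tr.cons h1 ih

lemma Tr.append {a b c : V} {l l' : List E} (h : Tr ends a l b) (h' : Tr ends b l' c) :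
    Tr ends a (l ++ l') c := by
  induction h with
  | nil a => exact h'
  | cons h1 _ ih => exact Tr.cons h1 (ih h')

lemma Tr.split {l l' : List E} : ∀ {a c : V}, Tr ends a (l ++ l') c →
    ∃ b, Tr ends a l b ∧ Tr ends b l' c := by
  induction l with
  | nil => intro a c h; exact ⟨a, Tr.nil a, h⟩
  | cons e l ih =>
    intro a c h
    cases h with
    | cons h1 h2 =>
      obtain ⟨b, hb, hb'⟩ := ih h2
      exact ⟨b, Tr.cons h1 hb, hb'⟩

lemma Reach.mono {F F' : Finset E} (h : F ⊆ F') {a b : V} (hr : Reach ends F a b) :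
    Reach ends F' a b := by
  induction hr with
  | refl => exact Relation.ReflTransGen.refl
  | tail _ h1 ih =>
    obtain ⟨e, he, h'⟩ := h1
    exact Relation.ReflTransGen.tail ih ⟨e, h he, h'⟩

lemma Reach.symm' {F : Finset E} {a b : V} (hr : Reach ends F a b) : Reach ends F b a := by
  induction hr with
  | refl => exact Relation.ReflTransGen.refl
  | tail _ h1 ih =>
    obtain ⟨e, he, h'⟩ := h1
    exact Relation.ReflTransGen.head ⟨e, he, by rw [h', Sym2.eq_swap]⟩ ih

lemma Reach.trans' {F : Finset E} {a b c : V} (h : Reach ends F a b) (h' : Reach ends F b c) :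
    Reach ends F a c := Relation.ReflTransGen.trans h h'

lemma Reach.rfl' {F : Finset E} {a : V} : Reach ends F a a := Relation.ReflTransGen.refl

lemma Reach.single {F : Finset E} {a b : V} {e : E} (he : e ∈ F) (h : ends e = s(a, b)) :
    Reach ends F a b := Relation.ReflTransGen.single ⟨e, he, h⟩

lemma Tr.reach {F : Finset E} {a b : V} {l : List E} (h : Tr ends a l b) (hl : ∀ e ∈ l, e ∈ F) :
    Reach ends F a b := by
  induction h with
  | nil a => exact Reach.rfl'
  | cons h1 _ ih =>
    exact (Reach.single (hl _ (by simp)) h1).trans' (ih fun e he => hl e (by simp [he]))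

lemma Reach.exists_tr {F : Finset E} {a b : V} (h : Reach ends F a b) :
    ∃ l, Tr ends a l b ∧ ∀ e ∈ l, e ∈ F := by
  induction h using Relation.ReflTransGen.head_induction_on with
  | refl => exact ⟨[], Tr.nil _, by simp⟩
  | head h1 _ ih =>
    obtain ⟨e, he, h1⟩ := h1
    obtain ⟨l, hl, hl'⟩ := ih
    exact ⟨e :: l, Tr.cons h1 hl, by simp_all⟩

lemma Tr.mem_end {a b : V} {l : List E} (h : Tr ends a l b) (hl : l ≠ []) :
    ∃ g ∈ l, b ∈ ends g := by
  induction h with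
  | nil a => simp at hl
  | @cons a b c e l h1 h2 ih =>
    by_cases h : l = []
    · subst h; cases h2; exact ⟨e, by simp, by simp [h1]⟩
    · obtain ⟨g, hg, hg'⟩ := ih h
      exact ⟨g, by simp [hg], hg'⟩

lemma Tr.mem_start {a b : V} {l : List E} (h : Tr ends a l b) (hl : l ≠ []) :
    ∃ g ∈ l, a ∈ ends g := by
  cases h with
  | nil a => simp at hl
  | cons h1 _ => exact ⟨_, List.mem_cons_self, by rw [h1]; simp⟩

lemma SP.split {l l' : List E} : ∀ {a c : V}, SP ends a (l ++ l') c →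
    ∃ b, SP ends a l b ∧ SP ends b l' c := by
  induction l with
  | nil => intro a c h; exact ⟨a, SP.nil a, h⟩
  | cons e l ih =>
    intro a c h
    cases h with
    | cons h1 h2 h3 h4 =>
      obtain ⟨b, hb, hb'⟩ := ih h4
      exact ⟨b, SP.cons h1 h2 (fun g hg => h3 g (by simp [hg])) hb, hb'⟩

lemma SP.closed {a : V} {l : List E} (h : SP ends a l a) : l = [] := by
  cases h with
  | nil a => rfl
  | @cons a b c e l h1 h2 h3 h4 =>
    exfalso
    by_cases hl : l = []
    · subst hl; cases h4; exact h2 rfl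
    · obtain ⟨g, hg, hg'⟩ := h4.tr.mem_end hl
      exact h3 g hg hg'

lemma Tr.visit {a b x : V} {l : List E} (h : Tr ends a l b) (hx : ∃ g ∈ l, x ∈ ends g) :
    ∃ l1 l2, l = l1 ++ l2 ∧ Tr ends a l1 x ∧ Tr ends x l2 b := by
  induction h with
  | nil a => simp at hx
  | @cons a b c e l h1 h2 ih =>
    by_cases hxl : ∃ g ∈ l, x ∈ ends g
    · obtain ⟨l1, l2, h3, h4, h5⟩ := ih hxl
      exact ⟨e :: l1, l2, by simp [h3], Tr.cons h1 h4, h5⟩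
    · obtain ⟨g, hg, hg'⟩ := hx
      have hge : g = e := by
        rcases List.mem_cons.1 hg with h | h
        · exact h
        · exact absurd ⟨g, h, hg'⟩ hxl
      rw [hge, h1, Sym2.mem_iff] at hg'
      rcases hg' with h | h
      · subst h; exact ⟨[], e :: l, rfl, Tr.nil _, Tr.cons h1 h2⟩
      · subst h; exact ⟨[e], l, rfl, Tr.cons h1 (Tr.nil _), h2⟩

lemma SP.visit {a b x : V} {l : List E} (h : SP ends a l b) (hx : ∃ g ∈ l, x ∈ ends g) :
    ∃ l1 l2, l = l1 ++ l2 ∧ SP ends a l1 x ∧ SP ends x l2 b := by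
  induction h with
  | nil a => simp at hx
  | @cons a b c e l h1 h2 h3 h4 ih =>
    by_cases hxl : ∃ g ∈ l, x ∈ ends g
    · obtain ⟨l1, l2, h5, h6, h7⟩ := ih hxl
      exact ⟨e :: l1, l2, by simp [h5], SP.cons h1 h2 (fun g hg => h3 g (by simp [h5, hg])) h6, h7⟩
    · obtain ⟨g, hg, hg'⟩ := hx
      have hge : g = e := by
        rcases List.mem_cons.1 hg with h | h
        · exact h
        · exact absurd ⟨g, h, hg'⟩ hxl
      rw [hge, h1, Sym2.mem_iff] at hg'
      rcases hg' with h | h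
      · subst h; exact ⟨[], e :: l, rfl, SP.nil _, SP.cons h1 h2 h3 h4⟩
      · subst h; exact ⟨[e], l, rfl, SP.cons h1 h2 (by simp) (SP.nil _), h4⟩

lemma Tr.prune {a b : V} {l : List E} (h : Tr ends a l b) :
    ∃ l', l'.Sublist l ∧ SP ends a l' b := by
  induction h with
  | nil a => exact ⟨[], List.Sublist.refl _, SP.nil a⟩
  | @cons a b c e l h1 h2 ih =>
    obtain ⟨l', hs, hp⟩ := ih
    by_cases hab : a = b
    · subst hab; exact ⟨l', hs.cons _, hp⟩
    by_cases hv : ∃ g ∈ l', a ∈ ends g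
    · obtain ⟨l1, l2, h3, _, h5⟩ := hp.visit hv
      refine ⟨l2, ?_, h5⟩
      have : l2.Sublist l' := by rw [h3]; exact List.sublist_append_right _ _
      exact (this.trans hs).cons _
    · push Not at hv
      exact ⟨e :: l', hs.cons_cons _, SP.cons h1 hab hv hp⟩

lemma SP.nodup {a b : V} {l : List E} (h : SP ends a l b) : l.Nodup := by
  induction h with
  | nil a => simp
  | @cons a b c e l h1 h2 h3 h4 ih =>
    refine List.nodup_cons.2 ⟨fun he => ?_, ih⟩
    exact h3 e he (by rw [h1]; simp)

lemma SP.not_loop {a b : V} {l : List E} (h : SP ends a l b) : ∀ g ∈ l, ¬ IsLoop ends g := by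
  induction h with
  | nil a => simp
  | @cons a b c e l h1 h2 h3 h4 ih =>
    intro g hg
    rcases List.mem_cons.1 hg with h | h
    · subst h; unfold IsLoop; rw [h1]; simpa using h2
    · exact ih g h

lemma mem_support {F : Finset E} {v : V} : v ∈ support ends F ↔ ∃ e ∈ F, v ∈ ends e := by
  simp [support]

lemma degree_insert {F : Finset E} {e : E} (he : e ∉ F) (v : V) :
    degree ends (insert e F) v =
      (if ends e = Sym2.diag v then 2 else if v ∈ ends e then 1 else 0) + degree ends F v := by
  unfold degree; rw [Finset.sum_insert he]

lemma degree_zero {F : Finset E} {v : V} (h : ∀ g ∈ F, v ∉ ends g) : degree ends F v = 0 := by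
  unfold degree
  refine Finset.sum_eq_zero fun e he => ?_
  have := h e he
  rw [if_neg, if_neg this]
  intro h'; rw [h'] at this; simp [Sym2.diag] at this

lemma degree_mono {F F' : Finset E} (h : F ⊆ F') (v : V) : degree ends F v ≤ degree ends F' v := by
  unfold degree
  exact Finset.sum_le_sum_of_subset h

lemma contrib {a b : V} (hab : a ≠ b) (v : V) {e : E} (he : ends e = s(a, b)) :
    (if ends e = Sym2.diag v then 2 else if v ∈ ends e then 1 else 0) =
      if v = a ∨ v = b then 1 else 0 := by
  rw [he, if_neg]
  · simp
  · simp only [Sym2.diag]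
    rw [Sym2.eq_iff]
    rintro (⟨h1, h2⟩ | ⟨h1, h2⟩) <;> exact hab (h1.trans h2.symm)

lemma SP.ne {a b : V} {l : List E} (h : SP ends a l b) (hl : l ≠ []) : a ≠ b := by
  rintro rfl; exact hl h.closed

lemma SP.deg {a b : V} {l : List E} (h : SP ends a l b) (hl : l ≠ []) :
    degree ends l.toFinset a = 1 ∧ degree ends l.toFinset b = 1 ∧
    ∀ w, (∃ g ∈ l, w ∈ ends g) → w ≠ a → w ≠ b → degree ends l.toFinset w = 2 := by
  induction h with
  | nil a => simp at hl
  | @cons a b c e l h1 h2 h3 h4 ih =>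
    have hn := (SP.cons h1 h2 h3 h4).nodup
    have hel : e ∉ l.toFinset := by simpa using (List.nodup_cons.1 hn).1
    have hac : a ≠ c := (SP.cons h1 h2 h3 h4).ne (by simp)
    have hz : degree ends l.toFinset a = 0 := degree_zero (by simpa using h3)
    simp only [List.toFinset_cons, degree_insert hel, contrib h2 _ h1, hz]
    by_cases hl' : l = []
    · subst hl'
      cases h4
      have : ∀ v, degree ends (∅ : Finset E) v = 0 := fun v => degree_zero (by simp)
      simp [this]
      intro w hw hwa hwb
      rw [h1] at hw; simp at hw; tauto
    · obtain ⟨i1, i2, i3⟩ := ih hl'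
      have hbc := h4.ne hl'
      refine ⟨by simp, by simp [hac.symm, hbc.symm, i2], ?_⟩
      intro w hw hwa hwc
      by_cases hwb : w = b
      · subst hwb; simp [i1]
      · simp only [hwa, hwb, or_self, if_false, zero_add]
        refine i3 w ?_ hwb hwc
        obtain ⟨g, hg, hg'⟩ := hw
        rcases List.mem_cons.1 hg with h | h
        · subst h; rw [h1] at hg'; simp at hg'; tauto
        · exact ⟨g, h, hg'⟩

lemma SP.isPath {a b : V} {l : List E} (h : SP ends a l b) (hl : l ≠ []) :
    IsPath ends l.toFinset a b := by
  obtain ⟨d1, d2, d3⟩ := h.deg hl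
  have hr : ∀ u ∈ support ends l.toFinset, Reach ends l.toFinset a u := by
    intro u hu
    rw [mem_support] at hu
    obtain ⟨l1, l2, h3, h4, _⟩ := h.visit (x := u) (by simpa using hu)
    exact h4.tr.reach (by intro e he; simp [h3, he])
  refine ⟨by simpa using hl, fun u hu v hv => (hr u hu).symm'.trans' (hr v hv), h.ne hl, ?_, ?_, d1, d2, ?_⟩
  · rw [mem_support]; simpa using h.tr.mem_start hl
  · rw [mem_support]; simpa using h.tr.mem_end hl
  · intro w hw; rw [mem_support] at hw; exact d3 w (by simpa using hw)

lemma mem_nbnl {e : E} : e ∈ nbnl ends ↔ ¬ IsBridgeIn ends univ e ∧ ¬ IsLoop ends e := by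
  simp [nbnl, nonbridges, bridges]

lemma mem_comp {e : E} {v : V} : e ∈ compBalloon ends v ↔
    e ∈ nbnl ends ∧ ∃ w ∈ ends e, Reach ends (nbnl ends) v w := by
  simp [compBalloon]

lemma comp_subset {v : V} : compBalloon ends v ⊆ nbnl ends := fun _ he => (mem_comp.1 he).1

lemma edge_reach {F : Finset E} {e : E} (he : e ∈ F) {x y : V} (hx : x ∈ ends e)
    (hy : y ∈ ends e) : Reach ends F x y := by
  by_cases hxy : x = y
  · subst hxy; exact Reach.rfl'
  · exact Reach.single he ((Sym2.mem_and_mem_iff hxy).1 ⟨hx, hy⟩)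

lemma comp_reach {e : E} {v x : V} (he : e ∈ compBalloon ends v) (hx : x ∈ ends e) :
    Reach ends (nbnl ends) v x := by
  obtain ⟨h1, w, hw, h2⟩ := mem_comp.1 he
  exact h2.trans' (edge_reach h1 hw hx)

lemma comp_supp_reach {v x : V} (hx : x ∈ support ends (compBalloon ends v)) :
    Reach ends (nbnl ends) v x := by
  obtain ⟨e, he, hx⟩ := mem_support.1 hx
  exact comp_reach he hx

lemma comp_eq {v x : V} (h : Reach ends (nbnl ends) v x) :
    compBalloon ends v = compBalloon ends x := by
  ext e
  simp only [mem_comp]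
  refine and_congr_right fun _ => ⟨?_, ?_⟩
  · rintro ⟨w, hw, h'⟩; exact ⟨w, hw, h.symm'.trans' h'⟩
  · rintro ⟨w, hw, h'⟩; exact ⟨w, hw, h.trans' h'⟩

lemma comp_closed {v x : V} (h : x ∈ support ends (compBalloon ends v)) {g : E}
    (hg : g ∈ nbnl ends) (hx : x ∈ ends g) : g ∈ compBalloon ends v :=
  mem_comp.2 ⟨hg, x, hx, comp_supp_reach h⟩

lemma mem_comp_self {e : E} {a : V} (he : e ∈ nbnl ends) (ha : a ∈ ends e) :
    e ∈ compBalloon ends a := mem_comp.2 ⟨he, a, ha, Reach.rfl'⟩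

lemma comp_reach_in {v x : V} (h : Reach ends (nbnl ends) v x) :
    Reach ends (compBalloon ends v) v x := by
  induction h with
  | refl => exact Reach.rfl'
  | @tail b c h1 h2 ih =>
    obtain ⟨e, he, h3⟩ := h2
    refine ih.trans' (Reach.single (e := e) ?_ h3)
    exact mem_comp.2 ⟨he, b, by rw [h3]; simp, h1⟩

lemma comp_connected (v : V) : ConnectedOn ends (compBalloon ends v) := fun _ hu _ hw =>
  (comp_reach_in (comp_supp_reach hu)).symm'.trans' (comp_reach_in (comp_supp_reach hw))

lemma degree_pos {F : Finset E} {v : V} {e : E} (he : e ∈ F) (hv : v ∈ ends e) :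
    1 ≤ degree ends F v := by
  have h1 : degree ends {e} v ≤ degree ends F v := degree_mono (by simpa using he) v
  refine le_trans ?_ h1
  unfold degree
  rw [Finset.sum_singleton]
  split_ifs <;> omega

lemma comp_circuit (htc : IsTreeOfCircuits ends) {v : V} (hne : (compBalloon ends v).Nonempty) :
    IsCircuit ends (compBalloon ends v) := by
  refine ⟨hne, comp_connected v, fun x hx => ?_⟩
  have h1 : degree ends (compBalloon ends v) x = degree ends (nbnl ends) x := by
    unfold degree
    refine Finset.sum_subset comp_subset fun e he he' => ?_
    have hxe : x ∉ ends e := fun h => he' (comp_closed hx he h)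
    rw [if_neg, if_neg hxe]
    intro h'; rw [h'] at hxe; simp [Sym2.diag] at hxe
  obtain ⟨e, he, hxe⟩ := mem_support.1 hx
  have h2 := degree_pos he hxe
  rcases htc.2 x with h | h <;> omega

lemma not_bridge {e : E} {a b : V} (h : ends e = s(a, b))
    (hr : Reach ends (univ.erase e) a b) : ¬ IsBridgeIn ends univ e := fun hb => hb.2 a b h hr

lemma cycle (htc : IsTreeOfCircuits ends) {e : E} {a b : V} {Q : List E} (he : e ∈ nbnl ends)
    (hab : ends e = s(a, b)) (hQ : SP ends b Q a) (heQ : e ∉ Q) :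
    (e :: Q).toFinset = compBalloon ends a := by
  have hne : a ≠ b := by
    rintro rfl
    exact (mem_nbnl.1 he).2 (by unfold IsLoop; rw [hab]; simp)
  have hQne : Q ≠ [] := by rintro rfl; cases hQ; exact hne rfl
  -- all edges of Q are in nbnl
  have hQn : ∀ g ∈ Q, g ∈ nbnl ends := by
    intro g hg
    refine mem_nbnl.2 ⟨?_, hQ.not_loop g hg⟩
    obtain ⟨l1, l2, hl⟩ := List.append_of_mem hg
    have hnd := hQ.nodup
    have hQt := hQ.tr
    rw [hl] at hQt hnd
    obtain ⟨x, h1, h2⟩ := hQt.split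
    cases h2 with
    | @cons _ y _ _ _ h3 h4 =>
      have hg1 : g ∉ l1 := by
        intro h; have := List.disjoint_of_nodup_append hnd h; simp at this
      have hg2 : g ∉ l2 := by
        have := (List.nodup_append.1 hnd).2.1
        exact (List.nodup_cons.1 this).1
      have hge : e ≠ g := by rintro rfl; exact heQ hg
      refine not_bridge h3 ?_
      have r1 : Reach ends (univ.erase g) b x := h1.reach (by
        intro f hf; simp; rintro rfl; exact hg1 hf)
      have r2 : Reach ends (univ.erase g) y a := h4.reach (by
        intro f hf; simp; rintro rfl; exact hg2 hf)
      have r3 : Reach ends (univ.erase g) a b := Reach.single (by simpa using hge) hab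
      exact (r2.trans' (r3.trans' r1)).symm'
  set Z := (e :: Q).toFinset with hZ
  have hZn : ∀ g ∈ Z, g ∈ nbnl ends := by
    intro g hg
    rw [hZ, List.mem_toFinset, List.mem_cons] at hg
    rcases hg with rfl | h
    · exact he
    · exact hQn g h
  have haZ : a ∈ support ends Z := mem_support.2 ⟨e, by simp [hZ], by rw [hab]; simp⟩
  obtain ⟨d1, d2, d3⟩ := hQ.deg hQne
  have hZdeg : ∀ w ∈ support ends Z, degree ends Z w = 2 := by
    intro w hw
    have : Z = insert e Q.toFinset := by simp [hZ]
    rw [this, degree_insert (by simpa using heQ), contrib hne _ hab]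
    by_cases hwa : w = a
    · subst hwa; simp [d2]
    by_cases hwb : w = b
    · subst hwb; simp [d1]
    simp only [hwa, hwb, or_self, if_false, zero_add]
    refine d3 w ?_ hwb hwa
    obtain ⟨g, hg, hg'⟩ := mem_support.1 hw
    rw [hZ, List.mem_toFinset, List.mem_cons] at hg
    rcases hg with rfl | h
    · rw [hab] at hg'; simp at hg'; tauto
    · exact ⟨g, h, hg'⟩
  have hcl : ∀ w ∈ support ends Z, ∀ g ∈ nbnl ends, w ∈ ends g → g ∈ Z := by
    intro w hw g hg hwg
    by_contra hgZ
    have h1 : degree ends (insert g Z) w ≤ degree ends (nbnl ends) w :=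
      degree_mono (by intro f hf; rcases Finset.mem_insert.1 hf with rfl | h; exacts [hg, hZn f h]) w
    rw [degree_insert hgZ, hZdeg w hw] at h1
    have h2 : 1 ≤ (if ends g = Sym2.diag w then 2 else if w ∈ ends g then 1 else 0) := by
      split_ifs <;> omega
    rcases htc.2 w with h | h <;> omega
  have hre : ∀ w, Reach ends (nbnl ends) a w → w ∈ support ends Z := by
    intro w hw
    induction hw with
    | refl => exact haZ
    | @tail x y _ h2 ih =>
      obtain ⟨g, hg, h3⟩ := h2
      exact mem_support.2 ⟨g, hcl x ih g hg (by rw [h3]; simp), by rw [h3]; simp⟩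
  ext g
  constructor
  · intro hg
    have hgn := hZn g hg
    rw [hZ, List.mem_toFinset, List.mem_cons] at hg
    rcases hg with rfl | h
    · exact mem_comp_self hgn (by rw [hab]; simp)
    · obtain ⟨l1, l2, hl⟩ := List.append_of_mem h
      have hQt := hQ.tr
      rw [hl] at hQt
      obtain ⟨x, h1, h2⟩ := hQt.split
      cases h2 with
      | @cons _ y _ _ _ h3 h4 =>
        refine mem_comp.2 ⟨hgn, x, by rw [h3]; simp, ?_⟩
        refine (Reach.single he hab).trans' (h1.reach fun f hf => hQn f ?_)
        rw [hl]; simp [hf]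
  · intro hg
    obtain ⟨h1, w, hw, h2⟩ := mem_comp.1 hg
    exact hcl w (hre w h2) g h1 hw

lemma exists_cycle (htc : IsTreeOfCircuits ends) {e : E} {a b : V} (he : e ∈ nbnl ends)
    (hab : ends e = s(a, b)) : ∃ Q, SP ends b Q a ∧ e ∉ Q ∧
      (e :: Q).toFinset = compBalloon ends a := by
  have h := (mem_nbnl.1 he).1
  have h2 : ∃ x y, ends e = s(x, y) ∧ Reach ends (univ.erase e) x y := by
    by_contra hc
    push Not at hc
    exact h ⟨mem_univ _, hc⟩
  obtain ⟨x, y, hxy, hr⟩ := h2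
  have hr' : Reach ends (univ.erase e) b a := by
    rw [hab, Sym2.eq_iff] at hxy
    rcases hxy with ⟨rfl, rfl⟩ | ⟨rfl, rfl⟩
    · exact hr.symm'
    · exact hr
  obtain ⟨l, hl, hl'⟩ := hr'.exists_tr
  obtain ⟨Q, hQ, hQ'⟩ := hl.prune
  have heQ : e ∉ Q := fun h => by simpa using hl' e (hQ.subset h)
  exact ⟨Q, hQ', heQ, cycle htc he hab hQ' heQ⟩

lemma two_cut (htc : IsTreeOfCircuits ends) {e f : E} {v x y : V} (he : e ∈ compBalloon ends v)
    (hf : f ∈ compBalloon ends v) (hef : e ≠ f) (hxy : ends f = s(x, y)) :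
    ¬ Reach ends ((univ.erase e).erase f) x y := by
  intro hr
  obtain ⟨l, hl, hl'⟩ := hr.symm'.exists_tr
  obtain ⟨Q, hQ, hQ'⟩ := hl.prune
  have hfQ : f ∉ Q := fun h => by simpa using hl' f (hQ.subset h)
  have heQ : e ∉ Q := fun h => by simpa using hl' e (hQ.subset h)
  have h1 := cycle htc (comp_subset hf) hxy hQ' hfQ
  have h2 : compBalloon ends v = compBalloon ends x :=
    comp_eq (comp_reach hf (by rw [hxy]; simp))
  rw [h2, ← h1] at he
  simp at he
  tauto

lemma gate {C : Finset E} {z u v : V} (hC : C = compBalloon ends z) (hu : u ∈ support ends C)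
    (hv : v ∈ support ends C) (hr : Reach ends (univ \ C) u v) : u = v := by
  by_contra hne
  obtain ⟨l, hl, hl'⟩ := hr.exists_tr
  obtain ⟨Q, hQ, hQ'⟩ := hl.prune
  have hn := hQ'.nodup
  have hnl := hQ'.not_loop
  cases hQ' with
  | nil => exact hne rfl
  | @cons _ y _ e l2 h1 h2 h3 h4 =>
    have heC : e ∉ C := by simpa using hl' e (hQ.subset (by simp))
    apply heC
    rw [hC] at hu ⊢
    refine comp_closed hu (mem_nbnl.2 ⟨?_, hnl e (by simp)⟩) (by rw [h1]; simp)
    refine not_bridge h1 ?_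
    have r1 : Reach ends (univ.erase e) y v := h4.tr.reach (by
        intro f hf; simp; rintro rfl; exact (List.nodup_cons.1 hn).1 hf)
    have r2 : Reach ends (univ.erase e) u v := by
      refine Reach.mono ?_ (comp_connected z u hu v (hC ▸ hv))
      intro f hf; simp; rintro rfl; exact heC (hC ▸ hf)
    exact r2.trans' r1.symm'

/-- first edge of a path in C -/
lemma SP.first_hit {C : Finset E} {a b : V} {l : List E} (h : SP ends a l b)
    (hx : ∃ g ∈ l, g ∈ C) : ∃ l1 l2 x, l = l1 ++ l2 ∧ SP ends a l1 x ∧ SP ends x l2 b ∧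
      x ∈ support ends C ∧ (∀ g ∈ l1, g ∉ C) ∧ ∃ g ∈ l2, g ∈ C := by
  induction h with
  | nil a => simp at hx
  | @cons a b c e l h1 h2 h3 h4 ih =>
    by_cases he : e ∈ C
    · exact ⟨[], e :: l, a, rfl, SP.nil _, SP.cons h1 h2 h3 h4,
        mem_support.2 ⟨e, he, by rw [h1]; simp⟩, by simp, e, by simp, he⟩
    · obtain ⟨l1, l2, x, i1, i2, i3, i4, i5, i6⟩ := ih (by simpa [he] using hx)
      refine ⟨e :: l1, l2, x, by simp [i1], SP.cons h1 h2 (fun g hg => h3 g (by simp [i1, hg])) i2,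
        i3, i4, ?_, i6⟩
      intro g hg
      rcases List.mem_cons.1 hg with rfl | h
      · exact he
      · exact i5 g h

/-- last edge of a path in C -/
lemma SP.last_hit {C : Finset E} {a b : V} {l : List E} (h : SP ends a l b)
    (hx : ∃ g ∈ l, g ∈ C) : ∃ l1 l2 x, l = l1 ++ l2 ∧ SP ends a l1 x ∧ SP ends x l2 b ∧
      x ∈ support ends C ∧ (∀ g ∈ l2, g ∉ C) ∧ l1 ≠ [] := by
  induction h with
  | nil a => simp at hx
  | @cons a b c e l h1 h2 h3 h4 ih =>
    by_cases he : ∃ g ∈ l, g ∈ C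
    · obtain ⟨l1, l2, x, i1, i2, i3, i4, i5, i6⟩ := ih he
      exact ⟨e :: l1, l2, x, by simp [i1], SP.cons h1 h2 (fun g hg => h3 g (by simp [i1, hg])) i2,
        i3, i4, i5, by simp⟩
    · have heC : e ∈ C := by
        obtain ⟨g, hg, hg'⟩ := hx
        rcases List.mem_cons.1 hg with rfl | h
        · exact hg'
        · exact absurd ⟨g, h, hg'⟩ he
      push Not at he
      exact ⟨[e], l, b, rfl, SP.cons h1 h2 (by simp) (SP.nil _), h4,
        mem_support.2 ⟨e, heC, by rw [h1]; simp⟩, he, by simp⟩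

lemma path_avoids {C : Finset E} {z a b : V} {l : List E} (hC : C = compBalloon ends z)
    (h : SP ends a l b) (hr : Reach ends (univ \ C) a b) : ∀ g ∈ l, g ∉ C := by
  by_contra hc
  push Not at hc
  obtain ⟨l1, l2, x, i1, i2, i3, i4, i5, i6⟩ := h.first_hit hc
  obtain ⟨m1, m2, y, j1, j2, j3, j4, j5, j6⟩ := i3.last_hit i6
  have hxy : x = y := by
    refine gate hC i4 j4 ?_
    have r1 : Reach ends (univ \ C) a x := i2.tr.reach (by intro f hf; simpa using i5 f hf)
    have r2 : Reach ends (univ \ C) y b := j3.tr.reach (by intro f hf; simpa using j5 f hf)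
    exact r1.symm'.trans' (hr.trans' r2.symm')
  subst hxy
  exact j6 j2.closed

lemma tour_aux (htc : IsTreeOfCircuits ends) (r : V) : ∀ (k : ℕ) (W : List E), Tr ends r W r →
    (∀ e ∈ nbnl ends, W.count e ≤ 1) → (∀ e, W.count e ≤ 2) →
    (∀ e ∈ nbnl ends, e ∈ W → ∀ x ∈ ends e, ∀ f ∈ compBalloon ends x, f ∈ W) →
    (univ.filter fun x => ¬ (x = r ∨ ∃ g ∈ W, x ∈ ends g)).card ≤ k →
    ∃ W, Tr ends r W r ∧ (∀ x, x = r ∨ ∃ g ∈ W, x ∈ ends g) ∧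
      (∀ e ∈ nbnl ends, W.count e ≤ 1) ∧ (∀ e, W.count e ≤ 2) := by
  intro k
  induction k with
  | zero =>
    intro W h1 h2 h3 h4 h5
    refine ⟨W, h1, fun x => ?_, h2, h3⟩
    by_contra hx
    rw [Nat.le_zero, Finset.card_eq_zero, Finset.filter_eq_empty_iff] at h5
    exact h5 (mem_univ x) hx
  | succ k ih =>
    intro W h1 h2 h3 h4 h5
    by_cases hall : ∀ x, x = r ∨ ∃ g ∈ W, x ∈ ends g
    · exact ⟨W, h1, hall, h2, h3⟩
    push Not at hall
    obtain ⟨y, hy⟩ := hall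
    have hedge : ∃ e a b, ends e = s(a, b) ∧ (a = r ∨ ∃ g ∈ W, a ∈ ends g) ∧
        ¬ (b = r ∨ ∃ g ∈ W, b ∈ ends g) := by
      by_contra hc
      push Not at hc
      have : ∀ z, Reach ends univ r z → (z = r ∨ ∃ g ∈ W, z ∈ ends g) := by
        intro z hz
        induction hz with
        | refl => exact Or.inl rfl
        | tail _ h ih' =>
          obtain ⟨e, _, he⟩ := h
          by_contra hb
          exact hb (hc e _ _ he ih')
      rcases this y (htc.1 r y) with h | ⟨g, hg, hg'⟩
      · exact hy.1 h
      · exact hy.2 g hg hg'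
    obtain ⟨e, a, b, hab, ha, hb⟩ := hedge
    have heW : e ∉ W := fun h => hb (Or.inr ⟨e, h, by rw [hab]; simp⟩)
    have hanb : a ≠ b := by rintro rfl; exact hb ha
    have hsplit : ∃ W1 W2, W = W1 ++ W2 ∧ Tr ends r W1 a ∧ Tr ends a W2 r := by
      rcases ha with rfl | ha
      · exact ⟨[], W, rfl, Tr.nil _, h1⟩
      · exact h1.visit ha
    obtain ⟨W1, W2, hW, hW1, hW2⟩ := hsplit
    have key : ∀ Z : List E, Tr ends a Z a → e ∈ Z →
        (∀ f ∈ nbnl ends, f ∈ Z → Z.count f ≤ 1 ∧ f ∉ W) → (∀ f ∈ Z, Z.count f ≤ 2 ∧ f ∉ W) →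
        (∀ f ∈ nbnl ends, f ∈ Z → ∀ x ∈ ends f, ∀ g ∈ compBalloon ends x, g ∈ Z) →
        ∃ W, Tr ends r W r ∧ (∀ x, x = r ∨ ∃ g ∈ W, x ∈ ends g) ∧
          (∀ e ∈ nbnl ends, W.count e ≤ 1) ∧ (∀ e, W.count e ≤ 2) := by
      intro Z hZ heZ z1 z2 z3
      have hcount : ∀ f, (W1 ++ Z ++ W2).count f = W.count f + Z.count f := by
        intro f; rw [hW]; simp only [List.count_append]; omega
      have hmem : ∀ f, f ∈ W1 ++ Z ++ W2 ↔ f ∈ W ∨ f ∈ Z := by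
        intro f; rw [hW]; simp only [List.mem_append]; tauto
      refine ih (W1 ++ Z ++ W2) ((hW1.append hZ).append hW2) ?_ ?_ ?_ ?_
      · intro f hf
        rw [hcount]
        by_cases hfZ : f ∈ Z
        · obtain ⟨p1, p2⟩ := z1 f hf hfZ
          rw [List.count_eq_zero_of_not_mem p2]; omega
        · rw [List.count_eq_zero_of_not_mem hfZ]; exact h2 f hf
      · intro f
        rw [hcount]
        by_cases hfZ : f ∈ Z
        · obtain ⟨p1, p2⟩ := z2 f hfZ
          rw [List.count_eq_zero_of_not_mem p2]; omega
        · rw [List.count_eq_zero_of_not_mem hfZ]; exact h3 f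
      · intro f hf hfW x hx g hg
        rw [hmem] at hfW ⊢
        rcases hfW with h | h
        · exact Or.inl (h4 f hf h x hx g hg)
        · exact Or.inr (z3 f hf h x hx g hg)
      · have : (univ.filter fun x => ¬ (x = r ∨ ∃ g ∈ W1 ++ Z ++ W2, x ∈ ends g)).card <
            (univ.filter fun x => ¬ (x = r ∨ ∃ g ∈ W, x ∈ ends g)).card := by
          apply Finset.card_lt_card
          refine Finset.ssubset_iff_of_subset ?_ |>.2 ⟨b, ?_, ?_⟩
          · intro x hx
            rw [Finset.mem_filter] at hx ⊢
            refine ⟨mem_univ _, fun h => hx.2 ?_⟩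
            rcases h with h | ⟨g, hg, hg'⟩
            · exact Or.inl h
            · exact Or.inr ⟨g, (hmem g).2 (Or.inl hg), hg'⟩
          · exact Finset.mem_filter.2 ⟨mem_univ _, hb⟩
          · rw [Finset.mem_filter]
            rintro ⟨_, h⟩
            exact h (Or.inr ⟨e, (hmem e).2 (Or.inr heZ), by rw [hab]; simp⟩)
        omega
    by_cases hen : e ∈ nbnl ends
    · obtain ⟨Q, q1, q2, q3⟩ := exists_cycle htc hen hab
      have hnd : (e :: Q).Nodup := List.nodup_cons.2 ⟨q2, q1.nodup⟩
      have hmemZ : ∀ f, f ∈ e :: Q ↔ f ∈ compBalloon ends a := by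
        intro f; rw [← q3, List.mem_toFinset]
      have hbx : ∀ f ∈ e :: Q, ∀ x ∈ ends f, compBalloon ends a = compBalloon ends x := by
        intro f hf x hx
        exact comp_eq (comp_reach ((hmemZ f).1 hf) hx)
      have hZW : ∀ f ∈ e :: Q, f ∉ W := by
        intro f hf hfW
        apply heW
        obtain ⟨x, hx⟩ : ∃ x, x ∈ ends f := ⟨_, Sym2.out_fst_mem _⟩
        refine h4 f (comp_subset ((hmemZ f).1 hf)) hfW x hx e ?_
        rw [← hbx f hf x hx, ← hmemZ]; simp
      refine key (e :: Q) (Tr.cons hab q1.tr) (by simp) ?_ ?_ ?_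
      · intro f _ hf; exact ⟨List.nodup_iff_count_le_one.1 hnd f, hZW f hf⟩
      · intro f hf
        have := List.nodup_iff_count_le_one.1 hnd f
        exact ⟨by omega, hZW f hf⟩
      · intro f _ hf x hx g hg
        rw [hmemZ, hbx f hf x hx]; exact hg
    · have hba : ends e = s(b, a) := by rw [hab, Sym2.eq_swap]
      refine key [e, e] (Tr.cons hab (Tr.cons hba (Tr.nil _))) (by simp) ?_ ?_ ?_
      · intro f hf hf'; simp at hf'; subst hf'; exact absurd hf hen
      · intro f hf; simp at hf; subst hf; exact ⟨by simp, heW⟩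
      · intro f hf hf'; simp at hf'; subst hf'; exact absurd hf hen

lemma tour_exists (htc : IsTreeOfCircuits ends) (r : V) :
    ∃ W, Tr ends r W r ∧ (∀ x, x = r ∨ ∃ g ∈ W, x ∈ ends g) ∧
      (∀ e ∈ nbnl ends, W.count e ≤ 1) ∧ (∀ e, W.count e ≤ 2) :=
  tour_aux htc r _ [] (Tr.nil r) (by simp) (by simp) (by simp) le_rfl

lemma Tr.det {l : List E} : ∀ {a b c : V}, Tr ends a l b → Tr ends a l c → b = c := by
  induction l with
  | nil => intro a b c h1 h2; cases h1; cases h2; rfl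
  | cons e l ih =>
    intro a b c h1 h2
    cases h1 with
    | cons p1 p2 =>
      cases h2 with
      | cons q1 q2 =>
        rw [p1] at q1
        have := Sym2.congr_right.1 q1
        subst this
        exact ih p2 q2

lemma sorted_enum {τ : Type} [Inhabited τ] (S : Finset τ) (p : τ → ℕ) :
    ∃ t : ℕ → τ, (∀ i < S.card, t i ∈ S) ∧ (∀ i < S.card, ∀ j < S.card, t i = t j → i = j) ∧
      ∀ i j, i < j → j < S.card → p (t i) ≤ p (t j) := by
  let T := S.toList.insertionSort (fun a b => p a ≤ p b)
  have hperm : T.Perm S.toList := List.perm_insertionSort _ _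
  have hlen : T.length = S.card := by rw [hperm.length_eq, Finset.length_toList]
  have hnd : T.Nodup := hperm.nodup_iff.2 S.nodup_toList
  have : Std.Total (fun a b : τ => p a ≤ p b) := ⟨fun a b => le_total _ _⟩
  have : IsTrans τ (fun a b : τ => p a ≤ p b) := ⟨fun a b c => le_trans⟩
  have hs : T.Pairwise (fun a b => p a ≤ p b) := List.pairwise_insertionSort _ _
  refine ⟨fun i => T.getD i default, ?_, ?_, ?_⟩
  · intro i hi
    rw [← hlen] at hi
    simp only [List.getD_eq_getElem _ _ hi]
    exact Finset.mem_toList.1 (hperm.mem_iff.1 (List.getElem_mem hi))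
  · intro i hi j hj h
    rw [← hlen] at hi hj
    simp only [List.getD_eq_getElem _ _ hi, List.getD_eq_getElem _ _ hj] at h
    exact (List.Nodup.getElem_inj_iff hnd).1 h
  · intro i j hij hj
    rw [← hlen] at hj
    have hi : i < T.length := hij.trans hj
    simp only [List.getD_eq_getElem _ _ hi, List.getD_eq_getElem _ _ hj]
    exact List.pairwise_iff_getElem.1 hs i j hi hj hij

lemma segments {τ : Type} [Inhabited τ] (S : Finset τ) (m : τ → V) {r : V} {W : List E}
    (hW : Tr ends r W r) (hv : ∀ x, x = r ∨ ∃ g ∈ W, x ∈ ends g) :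
    ∃ (t : ℕ → τ) (l : ℕ → List E), (∀ i < S.card, t i ∈ S) ∧
      (∀ i < S.card, ∀ j < S.card, t i = t j → i = j) ∧ t S.card = t 0 ∧
      (∀ i < S.card, Tr ends (m (t i)) (l i) (m (t (i + 1)))) ∧
      ∀ e, ∑ i ∈ range S.card, (l i).count e ≤ W.count e := by
  have hpos : ∀ x, ∃ k, Tr ends r (W.take k) x ∧ Tr ends x (W.drop k) r := by
    intro x
    rcases hv x with rfl | hx
    · exact ⟨0, by simpa using Tr.nil x, by simpa using hW⟩
    · obtain ⟨l1, l2, h1, h2, h3⟩ := hW.visit hx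
      exact ⟨l1.length, by simpa [h1] using h2, by simpa [h1] using h3⟩
  choose q hq1 hq2 using hpos
  obtain ⟨t, t1, t2, t3⟩ := sorted_enum S (fun a => q (m a))
  generalize hn : S.card = n at *
  rcases Nat.eq_zero_or_pos n with rfl | hnp
  · exact ⟨t, fun _ => [], by simp, by simp, rfl, by simp, by simp⟩
  obtain ⟨k, rfl⟩ : ∃ k, n = k + 1 := ⟨n - 1, by omega⟩
  let t' : ℕ → τ := fun i => if i < k + 1 then t i else t 0
  have ht' : ∀ i < k + 1, t' i = t i := fun i hi => by simp only [t', if_pos hi]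
  have ht'n : t' (k + 1) = t 0 := by simp [t']
  refine ⟨t', fun i => if i < k then (W.take (q (m (t (i+1))))).drop (q (m (t i)))
    else W.drop (q (m (t i))) ++ W.take (q (m (t 0))), ?_, ?_, ?_, ?_, ?_⟩
  · intro i hi; rw [ht' i hi]; exact t1 i hi
  · intro i hi j hj h; rw [ht' i hi, ht' j hj] at h; exact t2 i hi j hj h
  · rw [ht'n, ht' 0 hnp]
  · intro i hi
    rw [ht' i hi]
    by_cases hik : i < k
    · rw [ht' (i+1) (by omega)]
      simp only [if_pos hik]
      have hle := t3 i (i+1) (by omega) (by omega)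
      have h1 := hq1 (m (t (i+1)))
      rw [← List.take_append_drop (q (m (t i))) (W.take (q (m (t (i+1)))))] at h1
      obtain ⟨b, hb1, hb2⟩ := h1.split
      rw [List.take_take, min_eq_left hle] at hb1
      rwa [hb1.det (hq1 (m (t i)))] at hb2
    · have : i = k := by omega
      subst this
      rw [ht'n]
      simp only [if_neg hik]
      exact (hq2 _).append (hq1 _)
  · intro e
    rw [Finset.sum_range_succ]
    have hsum : ∀ j ≤ k, ∑ i ∈ range j, List.count e (if i < k then
        (W.take (q (m (t (i+1))))).drop (q (m (t i)))
        else W.drop (q (m (t i))) ++ W.take (q (m (t 0)))) + (W.take (q (m (t 0)))).count e =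
        (W.take (q (m (t j)))).count e := by
      intro j
      induction j with
      | zero => intro _; simp
      | succ j ih =>
        intro hj
        have := ih (by omega)
        rw [Finset.sum_range_succ]
        rw [if_pos (by omega : j < k)]
        have hle := t3 j (j+1) (by omega) (by omega)
        have h2 : (W.take (q (m (t (j+1))))).count e = (W.take (q (m (t j)))).count e +
            ((W.take (q (m (t (j+1))))).drop (q (m (t j)))).count e := by
          conv_lhs => rw [← List.take_append_drop (q (m (t j))) (W.take (q (m (t (j+1)))))]
          rw [List.count_append, List.take_take, min_eq_left hle]
        omega
    have h1 := hsum k le_rfl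
    have h2 : W.count e = (W.take (q (m (t k)))).count e + (W.drop (q (m (t k)))).count e := by
      rw [← List.count_append, List.take_append_drop]
    simp only [lt_irrefl, if_false, List.count_append] at h1 ⊢
    omega

/-- a block: a loop or a nontrivial balloon -/
def Blk (ends : E → Sym2 V) (t : Finset E) : Prop :=
  (∃ e, IsLoop ends e ∧ t = {e}) ∨ (t.Nonempty ∧ ∃ v, t = compBalloon ends v)

lemma loop_ends {e : E} (h : IsLoop ends e) : ∃ v, ends e = s(v, v) := by
  unfold IsLoop at h
  generalize ends e = z at h
  induction z with
  | h a b => simp at h; subst h; exact ⟨a, rfl⟩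

lemma loop_circuit {e : E} (h : IsLoop ends e) : IsCircuit ends {e} := by
  obtain ⟨v, hv⟩ := loop_ends h
  have hs : ∀ u ∈ support ends {e}, u = v := by
    intro u hu; rw [mem_support] at hu; simpa [hv] using hu
  refine ⟨by simp, ?_, ?_⟩
  · intro u hu w hw
    rw [hs u hu, hs w hw]; exact Reach.rfl'
  · intro u hu
    rw [hs u hu]
    unfold degree
    rw [Finset.sum_singleton, if_pos]
    rw [hv]; rfl

lemma blk_circuit (htc : IsTreeOfCircuits ends) {t : Finset E} (h : Blk ends t) :
    IsCircuit ends t := by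
  rcases h with ⟨e, he, rfl⟩ | ⟨hne, v, rfl⟩
  · exact loop_circuit he
  · exact comp_circuit htc hne

lemma blk_supp (htc : IsTreeOfCircuits ends) {t : Finset E} (h : Blk ends t) :
    (support ends t).Nonempty := by
  obtain ⟨e, he⟩ := (blk_circuit htc h).1
  exact ⟨_, mem_support.2 ⟨e, he, Sym2.out_fst_mem _⟩⟩

lemma blk_share {t t' : Finset E} (h : Blk ends t) (h' : Blk ends t') {e : E} (he : e ∈ t)
    (he' : e ∈ t') : t = t' := by
  rcases h with ⟨f, hf, rfl⟩ | ⟨hne, v, rfl⟩ <;> rcases h' with ⟨f', hf', rfl⟩ | ⟨hne', v', rfl⟩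
  · simp at he he'; rw [← he, ← he']
  · simp at he; subst he; exact absurd hf (mem_nbnl.1 (comp_subset he')).2
  · simp at he'; subst he'; exact absurd hf' (mem_nbnl.1 (comp_subset he)).2
  · rw [comp_eq (comp_reach he (Sym2.out_fst_mem _)), comp_eq (comp_reach he' (Sym2.out_fst_mem _))]

lemma blk_disj {t t' : Finset E} (h : Blk ends t) (h' : Blk ends t') (hne : t ≠ t') :
    Disjoint t t' := Finset.disjoint_left.2 fun _ he he' => hne (blk_share h h' he he')

lemma blk_inter {t t' : Finset E} (h : Blk ends t) (h' : Blk ends t') (hne : t ≠ t') {u v : V}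
    (hu : u ∈ support ends t) (hu' : u ∈ support ends t') (hv : v ∈ support ends t)
    (hv' : v ∈ support ends t') : u = v := by
  have hl : ∀ f, IsLoop ends f → u ∈ support ends {f} → v ∈ support ends {f} → u = v := by
    intro f hf h1 h2
    obtain ⟨w, hw⟩ := loop_ends hf
    rw [mem_support] at h1 h2
    simp [hw] at h1 h2
    rw [h1, h2]
  rcases h with ⟨f, hf, rfl⟩ | ⟨hn, x, rfl⟩
  · exact hl f hf hu hv
  rcases h' with ⟨f', hf', rfl⟩ | ⟨hn', x', rfl⟩
  · exact hl f' hf' hu' hv'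
  · exact absurd (by rw [comp_eq (comp_supp_reach hu), comp_eq (comp_supp_reach hu')]) hne

lemma blk_reach_off (htc : IsTreeOfCircuits ends) {s : Finset E} (hs : Blk ends s)
    {F : Finset E} (hF : Disjoint s F) {x y : V} (hx : x ∈ support ends s)
    (hy : y ∈ support ends s) : Reach ends (univ \ F) x y := by
  refine Reach.mono ?_ ((blk_circuit htc hs).2.1 x hx y hy)
  intro e he
  simpa using Finset.disjoint_left.1 hF he

lemma barbell (htc : IsTreeOfCircuits ends) {sgn : E → Bool} {t t' : Finset E} (ht : Blk ends t)
    (ht' : Blk ends t') (hne : t ≠ t') (ho : Odd (negEdges sgn t).card)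
    (ho' : Odd (negEdges sgn t').card) {x y : V} {l : List E} (hl : Tr ends x l y)
    (hx : x ∈ support ends t) (hy : y ∈ support ends t') :
    ∃ (P : List E) (a b : V), P.Sublist l ∧ SP ends a P b ∧ a ∈ support ends t ∧
      b ∈ support ends t' ∧ (∀ g ∈ P, g ∉ t ∧ g ∉ t') ∧
      IsSignedCircuit ends sgn (t ∪ t' ∪ P.toFinset) := by
  have hu : IsUnbalancedCircuit ends sgn t := ⟨blk_circuit htc ht, ho⟩
  have hu' : IsUnbalancedCircuit ends sgn t' := ⟨blk_circuit htc ht', ho'⟩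
  by_cases hv : ∃ v, v ∈ support ends t ∧ v ∈ support ends t'
  · obtain ⟨v, hv, hv'⟩ := hv
    refine ⟨[], v, v, by simp, SP.nil v, hv, hv', by simp, Or.inr (Or.inl ?_)⟩
    refine ⟨t, t', blk_disj ht ht' hne, by simp, hu, hu', v, ?_⟩
    ext w
    simp only [Finset.mem_inter, Finset.mem_singleton]
    constructor
    · rintro ⟨h1, h2⟩; exact blk_inter ht ht' hne h1 h2 hv hv'
    · rintro rfl; exact ⟨hv, hv'⟩
  push Not at hv
  let Q : ℕ → Prop := fun k => ∃ (P : List E) (a b : V), P.length = k ∧ P.Sublist l ∧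
    SP ends a P b ∧ a ∈ support ends t ∧ b ∈ support ends t'
  have hex : ∃ k, Q k := by
    obtain ⟨P, h1, h2⟩ := hl.prune
    exact ⟨_, P, x, y, rfl, h1, h2, hx, hy⟩
  obtain ⟨P, a, b, p1, p2, p3, p4, p5⟩ := Nat.find_spec hex
  have hmin : ∀ k, Q k → P.length ≤ k := by
    intro k hk; rw [p1]; exact Nat.find_min' hex hk
  have hPne : P ≠ [] := by
    rintro rfl; cases p3; exact hv _ p4 p5
  have i1 : ∀ w, (∃ g ∈ P, w ∈ ends g) → w ∈ support ends t → w = a := by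
    intro w hw hwt
    obtain ⟨l1, l2, q1, q2, q3⟩ := p3.visit hw
    have := hmin _ ⟨l2, w, b, rfl, (by rw [q1]; exact List.sublist_append_right _ _ :
      l2.Sublist P).trans p2, q3, hwt, p5⟩
    have h0 : l1 = [] := by
      rw [q1, List.length_append] at this
      exact List.length_eq_zero_iff.1 (by omega)
    subst h0; cases q2; rfl
  have i2 : ∀ w, (∃ g ∈ P, w ∈ ends g) → w ∈ support ends t' → w = b := by
    intro w hw hwt
    obtain ⟨l1, l2, q1, q2, q3⟩ := p3.visit hw
    have := hmin _ ⟨l1, a, w, rfl, (by rw [q1]; exact List.sublist_append_left _ _ :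
      l1.Sublist P).trans p2, q2, p4, hwt⟩
    have h0 : l2 = [] := by
      rw [q1, List.length_append] at this
      exact List.length_eq_zero_iff.1 (by omega)
    subst h0; cases q3; rfl
  have hoff : ∀ (s : Finset E) (c : V), (∀ w, (∃ g ∈ P, w ∈ ends g) → w ∈ support ends s → w = c) →
      ∀ g ∈ P, g ∉ s := by
    intro s c h g hg hgs
    apply p3.not_loop g hg
    unfold IsLoop
    have : ∀ w ∈ ends g, w = c := fun w hw => h w ⟨g, hg, hw⟩ (mem_support.2 ⟨g, hgs, hw⟩)
    generalize ends g = z at this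
    induction z with
    | h p q =>
      have e1 := this p (by simp)
      have e2 := this q (by simp)
      simp [e1, e2]
  have ha := p3.tr.mem_start hPne
  have hb := p3.tr.mem_end hPne
  have o1 := hoff t a i1
  have o2 := hoff t' b i2
  refine ⟨P, a, b, p2, p3, p4, p5, fun g hg => ⟨o1 g hg, o2 g hg⟩, Or.inr (Or.inr ?_)⟩
  refine ⟨t, t', P.toFinset, a, b, blk_disj ht ht' hne, ?_, ?_, rfl, hu, hu', ?_,
    p3.isPath hPne, ?_, ?_⟩
  · exact Finset.disjoint_right.2 fun g hg => o1 g (by simpa using hg)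
  · exact Finset.disjoint_right.2 fun g hg => o2 g (by simpa using hg)
  · exact Finset.disjoint_left.2 hv
  · ext w
    simp only [Finset.mem_inter, Finset.mem_singleton]
    constructor
    · rintro ⟨h1, h2⟩; rw [mem_support] at h1; exact i1 w (by simpa using h1) h2
    · rintro rfl; exact ⟨mem_support.2 (by simpa using ha), p4⟩
  · ext w
    simp only [Finset.mem_inter, Finset.mem_singleton]
    constructor
    · rintro ⟨h1, h2⟩; rw [mem_support] at h1; exact i2 w (by simpa using h1) h2
    · rintro rfl; exact ⟨mem_support.2 (by simpa using hb), p5⟩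

/-- all other terminals hang at the same place of `C` -/
def OS (ends : E → Sym2 V) (T : Finset (Finset E)) (C : Finset E) : Prop :=
  ∀ s ∈ T, ∀ s' ∈ T, s ≠ C → s' ≠ C → ∀ x ∈ support ends s, ∀ y ∈ support ends s',
    Reach ends (univ \ C) x y

lemma loop_OS (htc : IsTreeOfCircuits ends) {T : Finset (Finset E)} {e : E} (he : IsLoop ends e) :
    OS ends T {e} := by
  intro s _ s' _ _ _ x _ y hy; clear hy
  have := htc.1 x y
  induction this with
  | refl => exact Reach.rfl'
  | @tail b c _ h ih =>
    obtain ⟨g, _, hg⟩ := h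
    by_cases hge : g = e
    · subst hge
      obtain ⟨v, hv⟩ := loop_ends he
      rw [hv, Sym2.eq_iff] at hg
      have : b = c := by rcases hg with ⟨h1, h2⟩ | ⟨h1, h2⟩ <;> rw [← h1, ← h2]
      rw [← this]; exact ih
    · exact ih.trans' (Reach.single (by simpa using hge) hg)

lemma hit (htc : IsTreeOfCircuits ends) {t : Finset E} (x y : V) (hy : y ∈ support ends t) :
    ∃ y' ∈ support ends t, Reach ends (univ \ t) x y' := by
  have := htc.1 x y
  induction this using Relation.ReflTransGen.head_induction_on with
  | refl => exact ⟨y, hy, Reach.rfl'⟩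
  | @head a c h _ ih =>
    by_cases ha : a ∈ support ends t
    · exact ⟨a, ha, Reach.rfl'⟩
    · obtain ⟨g, _, hg⟩ := h
      obtain ⟨y', h1, h2⟩ := ih
      have : g ∉ t := fun hgt => ha (mem_support.2 ⟨g, hgt, by rw [hg]; simp⟩)
      exact ⟨y', h1, (Reach.single (by simpa using this) hg).trans' h2⟩

lemma leaf_exists (htc : IsTreeOfCircuits ends) {T : Finset (Finset E)}
    (hT : ∀ t ∈ T, Blk ends t) : ∀ (k : ℕ) (C : Finset E), Blk ends C → ∀ t ∈ T, t ≠ C →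
    (T.filter fun u => u ≠ C ∧ ∀ x ∈ support ends t, ∀ y ∈ support ends u,
      Reach ends (univ \ C) x y).card ≤ k →
    ∃ l ∈ T, l ≠ C ∧ OS ends T l ∧ ∀ x ∈ support ends t, ∀ y ∈ support ends l,
      Reach ends (univ \ C) x y := by
  intro k
  induction k with
  | zero =>
    intro C hC t ht htC hk
    rw [Nat.le_zero, Finset.card_eq_zero, Finset.filter_eq_empty_iff] at hk
    exact absurd ⟨htC, fun x hx y hy => blk_reach_off htc (hT t ht) (blk_disj (hT t ht) hC htC) hx hy⟩
      (hk ht)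
  | succ k ih =>
    intro C hC t ht htC hk
    have htt : ∀ x ∈ support ends t, ∀ y ∈ support ends t, Reach ends (univ \ C) x y :=
      fun x hx y hy => blk_reach_off htc (hT t ht) (blk_disj (hT t ht) hC htC) hx hy
    by_cases hos : OS ends T t
    · exact ⟨t, ht, htC, hos, htt⟩
    unfold OS at hos
    push Not at hos
    obtain ⟨s1, hs1, s2, hs2, n1, n2, x1, hx1, x2, hx2, hnr⟩ := hos
    obtain ⟨c, hc⟩ := blk_supp htc hC
    have hCt : Disjoint C t := blk_disj hC (hT t ht) htC.symm
    have hpick : ∃ s ∈ T, s ≠ t ∧ ∃ x ∈ support ends s, ¬ Reach ends (univ \ t) x c := by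
      by_cases h1 : Reach ends (univ \ t) x1 c
      · refine ⟨s2, hs2, n2, x2, hx2, fun h2 => hnr (h1.trans' h2.symm')⟩
      · exact ⟨s1, hs1, n1, x1, hx1, h1⟩
    obtain ⟨s, hs, hst, x, hx, hxc⟩ := hpick
    have hav : ∀ z, Reach ends (univ \ t) x z → Reach ends (univ \ C) x z := by
      intro z hz
      induction hz with
      | refl => exact Reach.rfl'
      | @tail b z h1 h2 ih' =>
        obtain ⟨g, hg, hg'⟩ := h2
        have hgC : g ∉ C := by
          intro hgC
          apply hxc
          exact Reach.trans' h1 (blk_reach_off htc hC hCt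
            (mem_support.2 ⟨g, hgC, by rw [hg']; simp⟩) hc)
        exact ih'.trans' (Reach.single (by simpa using hgC) hg')
    obtain ⟨w, hw⟩ := blk_supp htc (hT t ht)
    obtain ⟨y', hy', hxy'⟩ := hit htc x w hw
    have claim : ∀ u ∈ T, u ≠ t → (∀ x ∈ support ends s, ∀ y ∈ support ends u,
        Reach ends (univ \ t) x y) → u ≠ C ∧ ∀ x ∈ support ends t, ∀ y ∈ support ends u,
        Reach ends (univ \ C) x y := by
      intro u hu hut hr
      constructor
      · rintro rfl
        exact hxc (hr x hx c hc)
      · intro x0 hx0 y hy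
        exact (htt x0 hx0 y' hy').trans' ((hav y' hxy').symm'.trans' (hav y (hr x hx y hy)))
    have hlt : (T.filter fun u => u ≠ t ∧ ∀ x ∈ support ends s, ∀ y ∈ support ends u,
        Reach ends (univ \ t) x y).card < (T.filter fun u => u ≠ C ∧ ∀ x ∈ support ends t,
        ∀ y ∈ support ends u, Reach ends (univ \ C) x y).card := by
      apply Finset.card_lt_card
      refine Finset.ssubset_iff_of_subset ?_ |>.2 ⟨t, ?_, ?_⟩
      · intro u hu
        rw [Finset.mem_filter] at hu ⊢
        exact ⟨hu.1, claim u hu.1 hu.2.1 hu.2.2⟩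
      · exact Finset.mem_filter.2 ⟨ht, htC, htt⟩
      · rw [Finset.mem_filter]; rintro ⟨_, h, _⟩; exact h rfl
    obtain ⟨l, hl, hlt', hlos, hlr⟩ := ih t (hT t ht) s hs hst (by omega)
    obtain ⟨c1, c2⟩ := claim l hl hlt' hlr
    exact ⟨l, hl, c1, hlos, c2⟩

lemma two_leaves (htc : IsTreeOfCircuits ends) {T : Finset (Finset E)}
    (hT : ∀ t ∈ T, Blk ends t) {C : Finset E} (hC : Blk ends C) (hos : ¬ OS ends T C) :
    ∃ l ∈ T, ∃ l' ∈ T, OS ends T l ∧ OS ends T l' ∧ l ≠ C ∧ l' ≠ C ∧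
      ∀ x ∈ support ends l, ∀ y ∈ support ends l', ¬ Reach ends (univ \ C) x y := by
  unfold OS at hos
  push Not at hos
  obtain ⟨s1, hs1, s2, hs2, n1, n2, x1, hx1, x2, hx2, hnr⟩ := hos
  obtain ⟨l, p1, p2, p3, p4⟩ := leaf_exists htc hT _ C hC s1 hs1 n1 le_rfl
  obtain ⟨l', q1, q2, q3, q4⟩ := leaf_exists htc hT _ C hC s2 hs2 n2 le_rfl
  refine ⟨l, p1, l', q1, p3, q3, p2, q2, fun x hx y hy hr => hnr ?_⟩
  exact (p4 x1 hx1 x hx).trans' (hr.trans' (q4 x2 hx2 y hy).symm')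

lemma chain {F : Finset E} {t : ℕ → Finset E} {lo hi : ℕ}
    (h0 : ∀ x ∈ support ends (t lo), ∀ y ∈ support ends (t lo), Reach ends F x y)
    (hne : ∀ i, lo ≤ i → i ≤ hi → (support ends (t i)).Nonempty)
    (hs : ∀ i, lo ≤ i → i < hi → ∀ x ∈ support ends (t i), ∀ y ∈ support ends (t (i + 1)),
      Reach ends F x y) :
    ∀ i, lo ≤ i → i ≤ hi → ∀ x ∈ support ends (t lo), ∀ y ∈ support ends (t i),
      Reach ends F x y := by
  intro i hi1
  induction i, hi1 using Nat.le_induction with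
  | base => intro _; exact h0
  | succ i h1 ih =>
    intro h2 x hx y hy
    obtain ⟨z, hz⟩ := hne i h1 (by omega)
    exact (ih (by omega) x hx z hz).trans' (hs i h1 (by omega) z hz y hy)

lemma cover (htc : IsTreeOfCircuits ends) {C : Finset E} {z : V} (hC : Blk ends C)
    (hCz : C = compBalloon ends z) {n : ℕ} {t : ℕ → Finset E} {P : ℕ → List E} {a b : ℕ → V}
    (ht : ∀ i < n, Blk ends (t i)) (htC : ∀ i < n, t i ≠ C) (hn : t n = t 0)
    (hP : ∀ i < n, SP ends (a i) (P i) (b i)) (ha : ∀ i < n, a i ∈ support ends (t i))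
    (hb : ∀ i < n, b i ∈ support ends (t (i + 1)))
    (hcap : ∀ f ∈ C, ∑ i ∈ range n, (P i).count f ≤ 1)
    {i j : ℕ} (hi : i < n) (hj : j < n) (hij : ∀ x ∈ support ends (t i),
      ∀ y ∈ support ends (t j), ¬ Reach ends (univ \ C) x y) :
    ∀ e ∈ C, ∃ i < n, e ∈ P i := by
  intro e he
  by_contra hne
  push Not at hne
  have ht' : ∀ i ≤ n, Blk ends (t i) ∧ t i ≠ C := by
    intro i hi
    rcases Nat.lt_or_ge i n with h | h
    · exact ⟨ht i h, htC i h⟩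
    · rw [le_antisymm hi h, hn]; exact ⟨ht 0 (by omega), htC 0 (by omega)⟩
  have hsup : ∀ i ≤ n, (support ends (t i)).Nonempty := fun i hi => blk_supp htc (ht' i hi).1
  have hin : ∀ F : Finset E, F ⊆ C → ∀ i ≤ n, ∀ x ∈ support ends (t i), ∀ y ∈ support ends (t i),
      Reach ends (univ \ F) x y := fun F hF i hi x hx y hy =>
    blk_reach_off htc (ht' i hi).1
      (Finset.disjoint_of_subset_right hF (blk_disj (ht' i hi).1 hC (ht' i hi).2)) hx hy
  have hstep : ∀ F : Finset E, F ⊆ C → ∀ i < n, (∀ g ∈ P i, g ∉ F) →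
      ∀ x ∈ support ends (t i), ∀ y ∈ support ends (t (i + 1)), Reach ends (univ \ F) x y := by
    intro F hF i hi hg x hx y hy
    have r1 := hin F hF i hi.le x hx (a i) (ha i hi)
    have r2 := hin F hF (i + 1) hi (b i) (hb i hi) y hy
    exact r1.trans' (((hP i hi).tr.reach (by intro f hf; simpa using hg f hf)).trans' r2)
  by_cases hA : ∀ i < n, ∀ g ∈ P i, g ∉ C
  · have hc := chain (F := univ \ C) (t := t) (lo := 0) (hi := n) (hin C subset_rfl 0 (by omega))
      (fun i _ h => hsup i h) (fun i _ h => hstep C subset_rfl i h (hA i h))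
    obtain ⟨x, hx⟩ := hsup i hi.le
    obtain ⟨y, hy⟩ := hsup j hj.le
    obtain ⟨w, hw⟩ := hsup 0 (by omega)
    exact hij x hx y hy ((hc i (by omega) hi.le w hw x hx).symm'.trans'
      (hc j (by omega) hj.le w hw y hy))
  · push Not at hA
    obtain ⟨i0, hi0, f, hfP, hfC⟩ := hA
    have hef : e ≠ f := by rintro rfl; exact hne i0 hi0 hfP
    have huniq : ∀ k < n, k ≠ i0 → f ∉ P k := by
      intro k hk hki hfk
      have h1 : ∑ i ∈ ({i0, k} : Finset ℕ), (P i).count f ≤ ∑ i ∈ range n, (P i).count f := by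
        apply Finset.sum_le_sum_of_subset
        intro q hq
        simp only [Finset.mem_insert, Finset.mem_singleton] at hq
        rcases hq with rfl | rfl <;> simpa
      rw [Finset.sum_pair hki.symm] at h1
      have h2 := List.count_pos_iff.2 hfP
      have h3 := List.count_pos_iff.2 hfk
      have := hcap f hfC
      omega
    have hF : ({e, f} : Finset E) ⊆ C := by
      intro q hq
      simp only [Finset.mem_insert, Finset.mem_singleton] at hq
      rcases hq with rfl | rfl <;> assumption
    have hs : ∀ i < n, i ≠ i0 → ∀ x ∈ support ends (t i), ∀ y ∈ support ends (t (i + 1)),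
        Reach ends (univ \ {e, f}) x y := by
      intro i hi hii
      refine hstep _ hF i hi ?_
      intro g hg hg'
      simp only [Finset.mem_insert, Finset.mem_singleton] at hg'
      rcases hg' with rfl | rfl
      · exact hne i hi hg
      · exact huniq i hi hii hg
    have c1 := chain (F := univ \ {e, f}) (t := t) (lo := 0) (hi := i0) (hin _ hF 0 (by omega))
      (fun i _ h => hsup i (by omega)) (fun i _ h => hs i (by omega) (by omega)) i0 (by omega) le_rfl
    have c2 := chain (F := univ \ {e, f}) (t := t) (lo := i0 + 1) (hi := n)
      (hin _ hF (i0 + 1) (by omega))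
      (fun i _ h => hsup i (by omega)) (fun i _ h => hs i (by omega) (by omega)) n (by omega) le_rfl
    rw [hn] at c2
    obtain ⟨w, hw⟩ := hsup 0 (by omega)
    have hba : Reach ends (univ \ {e, f}) (b i0) (a i0) :=
      (c2 _ (hb i0 hi0) w hw).trans' (c1 w hw _ (ha i0 hi0))
    obtain ⟨l1, l2, hl⟩ := List.append_of_mem hfP
    have hPt := (hP i0 hi0).tr
    have hnd := (hP i0 hi0).nodup
    have heP := hne i0 hi0
    rw [hl] at hPt hnd heP
    obtain ⟨x, h1, h2⟩ := hPt.split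
    cases h2 with
    | @cons _ y _ _ _ h3 h4 =>
      have hf1 : f ∉ l1 := by
        intro h; have := List.disjoint_of_nodup_append hnd h; simp at this
      have hf2 : f ∉ l2 := by
        have := (List.nodup_append.1 hnd).2.1
        exact (List.nodup_cons.1 this).1
      have r1 : Reach ends (univ \ {e, f}) (a i0) x := h1.reach (by
        intro g hg; simp; refine ⟨?_, ?_⟩ <;> rintro rfl
        · exact heP (by simp [hg])
        · exact hf1 hg)
      have r2 : Reach ends (univ \ {e, f}) y (b i0) := h4.reach (by
        intro g hg; simp; refine ⟨?_, ?_⟩ <;> rintro rfl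
        · exact heP (by simp [hg])
        · exact hf2 hg)
      refine two_cut htc (hCz ▸ he) (hCz ▸ hfC) hef h3 ?_
      refine Reach.mono ?_ (r2.trans' (hba.trans' r1)).symm'
      intro g hg
      simp at hg ⊢
      tauto


structure Fam (ends : E → Sym2 V) (sgn : E → Bool) (S : Finset (Finset E)) (n : ℕ)
    (t : ℕ → Finset E) (P : ℕ → List E) (a b : ℕ → V) : Prop where
  hn : n = S.card
  blk : ∀ s ∈ S, Blk ends s
  mem : ∀ i < n, t i ∈ S
  mem' : ∀ i < n, t (i + 1) ∈ S
  wrap : t n = t 0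
  surj : ∀ s ∈ S, ∃ i < n, t i = s
  sp : ∀ i < n, SP ends (a i) (P i) (b i)
  ha : ∀ i < n, a i ∈ support ends (t i)
  hb : ∀ i < n, b i ∈ support ends (t (i + 1))
  off : ∀ i < n, ∀ g ∈ P i, g ∉ t i ∧ g ∉ t (i + 1)
  sc : ∀ i < n, IsSignedCircuit ends sgn (t i ∪ t (i + 1) ∪ (P i).toFinset)
  cap1 : ∀ e ∈ nbnl ends, ∑ i ∈ range n, (P i).count e ≤ 1
  cap2 : ∀ e, ∑ i ∈ range n, (P i).count e ≤ 2
  pos : ∀ s ∈ S, ∃ i₀ < n, ∃ j₀ < n, i₀ ≠ j₀ ∧ (Even n → (Even i₀ ↔ ¬ Even j₀)) ∧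
    ∀ i < n, (t i = s ∨ t (i + 1) = s ↔ i = i₀ ∨ i = j₀)

lemma fam_exists [Nonempty V] (htc : IsTreeOfCircuits ends) {sgn : E → Bool}
    (S : Finset (Finset E)) (hS : ∀ s ∈ S, Blk ends s ∧ Odd (negEdges sgn s).card)
    (h1 : S.card ≠ 1) : ∃ t P a b, Fam ends sgn S S.card t P a b := by
  obtain ⟨r⟩ := ‹Nonempty V›
  obtain ⟨W, w1, w2, w3, w4⟩ := tour_exists htc r
  have hm : ∀ s : Finset E, ∃ v, Blk ends s → v ∈ support ends s := by
    intro s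
    by_cases h : Blk ends s
    · obtain ⟨v, hv⟩ := blk_supp htc h
      exact ⟨v, fun _ => hv⟩
    · exact ⟨r, fun h' => absurd h' h⟩
  choose m hm using hm
  obtain ⟨t, l, t1, t2, t3, t4, t5⟩ := segments S m w1 w2
  generalize hn : S.card = n at *
  have hmem' : ∀ i < n, t (i + 1) ∈ S := by
    intro i hi
    rcases Nat.lt_or_ge (i + 1) n with h | h
    · exact t1 _ h
    · have : i + 1 = n := by omega
      rw [this, t3]; exact t1 _ (by omega)
  have hne : ∀ i < n, t i ≠ t (i + 1) := by
    intro i hi h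
    rcases Nat.lt_or_ge (i + 1) n with h' | h'
    · have := t2 _ hi _ h' h; omega
    · have h2 : i + 1 = n := by omega
      rw [h2, t3] at h
      have := t2 _ hi _ (by omega) h; omega
  have hsurj : ∀ s ∈ S, ∃ i < n, t i = s := by
    have : (range n).image t = S := by
      apply Finset.eq_of_subset_of_card_le
      · intro s hs
        obtain ⟨i, hi, rfl⟩ := Finset.mem_image.1 hs
        exact t1 i (by simpa using hi)
      · rw [Finset.card_image_of_injOn, hn]; · simp
        intro i hi j hj h
        exact t2 i (by simpa using hi) j (by simpa using hj) h
    intro s hs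
    rw [← this] at hs
    obtain ⟨i, hi, h⟩ := Finset.mem_image.1 hs
    exact ⟨i, by simpa using hi, h⟩
  have hbar : ∀ i, ∃ (P : List E) (a b : V), i < n → P.Sublist (l i) ∧ SP ends a P b ∧
      a ∈ support ends (t i) ∧ b ∈ support ends (t (i + 1)) ∧
      (∀ g ∈ P, g ∉ t i ∧ g ∉ t (i + 1)) ∧
      IsSignedCircuit ends sgn (t i ∪ t (i + 1) ∪ P.toFinset) := by
    intro i
    by_cases hi : i < n
    · have k1 := hS _ (t1 i hi)
      have k2 := hS _ (hmem' i hi)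
      obtain ⟨P, a, b, h⟩ := barbell htc k1.1 k2.1 (hne i hi) k1.2 k2.2 (t4 i hi)
        (hm _ k1.1) (hm _ k2.1)
      exact ⟨P, a, b, fun _ => h⟩
    · exact ⟨[], r, r, fun h => absurd h hi⟩
  choose P a b hP using hbar
  have hle : ∀ e, ∑ i ∈ range n, (P i).count e ≤ W.count e := fun e =>
    le_trans (Finset.sum_le_sum fun i hi => (hP i (by simpa using hi)).1.count_le e) (t5 e)
  refine ⟨t, P, a, b, hn.symm, fun s hs => (hS s hs).1, t1, hmem', t3, hsurj,
    fun i hi => (hP i hi).2.1, fun i hi => (hP i hi).2.2.1, fun i hi => (hP i hi).2.2.2.1,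
    fun i hi => (hP i hi).2.2.2.2.1, fun i hi => (hP i hi).2.2.2.2.2,
    fun e he => (hle e).trans (w3 e he), fun e => (hle e).trans (w4 e), ?_⟩
  intro s hs
  obtain ⟨i, hi, rfl⟩ := hsurj s hs
  refine ⟨i, hi, if i = 0 then n - 1 else i - 1, by split_ifs <;> omega, by split_ifs <;> omega,
    ?_, ?_⟩
  · intro hev
    simp only [Nat.even_iff] at hev ⊢
    split_ifs <;> omega
  · intro k hk
    constructor
    · rintro (h | h)
      · exact Or.inl (t2 _ hk _ hi h)
      · right
        rcases Nat.lt_or_ge (k + 1) n with h' | h'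
        · have := t2 _ h' _ hi h
          split_ifs <;> omega
        · have h2 : k + 1 = n := by omega
          rw [h2, t3] at h
          have := t2 _ (by omega) _ hi h
          split_ifs <;> omega
    · rintro (rfl | h)
      · exact Or.inl rfl
      · right
        split_ifs at h with h0
        · have h2 : k + 1 = n := by omega
          rw [h2, t3, h0]
        · have h2 : k + 1 = i := by omega
          rw [h2]

/-- the barbells of a family -/
def BB (t : ℕ → Finset E) (P : ℕ → List E) (i : ℕ) : Finset E :=
  t i ∪ t (i + 1) ∪ (P i).toFinset

lemma mem_BB {t : ℕ → Finset E} {P : ℕ → List E} {i : ℕ} {e : E} :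
    e ∈ BB t P i ↔ (e ∈ t i ∨ e ∈ t (i + 1)) ∨ e ∈ P i := by
  simp [BB, or_assoc]

lemma card_P_le (n : ℕ) (P : ℕ → List E) (e : E) :
    ((range n).filter fun i => e ∈ P i).card ≤ ∑ i ∈ range n, (P i).count e := by
  rw [Finset.card_filter]
  refine Finset.sum_le_sum fun i _ => ?_
  split_ifs with h
  · exact List.count_pos_iff.2 h
  · exact Nat.zero_le _

section famlem
variable {sgn : E → Bool} {S : Finset (Finset E)} {n : ℕ} {t : ℕ → Finset E} {P : ℕ → List E}
  {a b : ℕ → V}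

/-- edges in no member of the family -/
lemma Fam.card_out (F : Fam ends sgn S n t P a b) {e : E} (he : ∀ s ∈ S, e ∉ s) :
    ((range n).filter fun i => e ∈ BB t P i).card ≤ ∑ i ∈ range n, (P i).count e := by
  refine le_trans (Finset.card_le_card ?_) (card_P_le n P e)
  intro i hi
  simp only [Finset.mem_filter, mem_BB, Finset.mem_range] at hi ⊢
  refine ⟨hi.1, hi.2.resolve_left ?_⟩
  rintro (h | h)
  · exact he _ (F.mem i hi.1) h
  · exact he _ (F.mem' i hi.1) h

lemma Fam.mem_iff (F : Fam ends sgn S n t P a b) {s : Finset E} (hs : Blk ends s) {e : E}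
    (he : e ∈ s) {i : ℕ} (hi : i < n) : e ∈ BB t P i ↔ (t i = s ∨ t (i + 1) = s) ∨ e ∈ P i := by
  rw [mem_BB]
  have h1 : ∀ u ∈ S, (e ∈ u ↔ u = s) := fun u hu =>
    ⟨fun h => blk_share (F.blk u hu) hs h he, fun h => h ▸ he⟩
  rw [h1 _ (F.mem i hi), h1 _ (F.mem' i hi)]

lemma Fam.card_in (F : Fam ends sgn S n t P a b) {s : Finset E} (hs : s ∈ S) {e : E}
    (he : e ∈ s) : ((range n).filter fun i => e ∈ BB t P i).card ≤
      2 + ∑ i ∈ range n, (P i).count e := by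
  obtain ⟨i₀, h1, j₀, h2, h3, h4, h5⟩ := F.pos s hs
  have : ((range n).filter fun i => e ∈ BB t P i) ⊆
      {i₀, j₀} ∪ ((range n).filter fun i => e ∈ P i) := by
    intro i hi
    simp only [Finset.mem_filter, Finset.mem_range] at hi
    have := (F.mem_iff (F.blk s hs) he hi.1).1 hi.2
    rw [h5 i hi.1] at this
    simp [hi.1]; tauto
  refine (Finset.card_le_card this).trans ((Finset.card_union_le _ _).trans ?_)
  exact Nat.add_le_add Finset.card_le_two (card_P_le n P e)

lemma Fam.avoid (F : Fam ends sgn S n t P a b) {T : Finset (Finset E)} (hST : S ⊆ T)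
    {s : Finset E} (hs : Blk ends s) (hos : OS ends T s) {e : E} (he : e ∈ s) {i : ℕ}
    (hi : i < n) : e ∉ P i := by
  intro h
  rcases hs with ⟨f, hf, rfl⟩ | ⟨hne, v, hv⟩
  · simp at he; subst he
    exact (F.sp i hi).not_loop e h hf
  · have h1 : t i ≠ s := fun h' => (F.off i hi e h).1 (h' ▸ he)
    have h2 : t (i + 1) ≠ s := fun h' => (F.off i hi e h).2 (h' ▸ he)
    exact path_avoids hv (F.sp i hi) (hos _ (hST (F.mem i hi)) _ (hST (F.mem' i hi)) h1 h2 _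
      (F.ha i hi) _ (F.hb i hi)) e h he

lemma Fam.sum_zero (F : Fam ends sgn S n t P a b) {T : Finset (Finset E)} (hST : S ⊆ T)
    {s : Finset E} (hs : Blk ends s) (hos : OS ends T s) {e : E} (he : e ∈ s) :
    ∑ i ∈ range n, (P i).count e = 0 :=
  Finset.sum_eq_zero fun i hi =>
    List.count_eq_zero.2 (F.avoid hST hs hos he (by simpa using hi))

lemma Fam.card_two (F : Fam ends sgn S n t P a b) {T : Finset (Finset E)} (hST : S ⊆ T)
    {s : Finset E} (hs : s ∈ S) (hos : OS ends T s) {e : E} (he : e ∈ s) :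
    ((range n).filter fun i => e ∈ BB t P i).card = 2 := by
  obtain ⟨i₀, h1, j₀, h2, h3, h4, h5⟩ := F.pos s hs
  have : ((range n).filter fun i => e ∈ BB t P i) = {i₀, j₀} := by
    ext i
    simp only [Finset.mem_filter, Finset.mem_range, Finset.mem_insert, Finset.mem_singleton]
    constructor
    · rintro ⟨hi, h⟩
      rw [F.mem_iff (F.blk s hs) he hi, h5 i hi] at h
      exact h.resolve_right (F.avoid hST (F.blk s hs) hos he hi)
    · intro h
      have hi : i < n := by rcases h with rfl | rfl <;> assumption
      exact ⟨hi, (F.mem_iff (F.blk s hs) he hi).2 (Or.inl ((h5 i hi).2 h))⟩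
  rw [this, Finset.card_pair h3]

end famlem

lemma widthAt_append (l l' : List (Finset E)) (e : E) :
    widthAt (l ++ l') e = widthAt l e + widthAt l' e := by
  simp [widthAt]

lemma widthAt_toList (s : Finset (Finset E)) (e : E) :
    widthAt s.toList e = (s.filter fun C => e ∈ C).card := by
  unfold widthAt
  rw [← Multiset.coe_card, ← Multiset.filter_coe, Finset.coe_toList]
  rfl

lemma widthAt_map (I : Finset ℕ) (B : ℕ → Finset E) (e : E) :
    widthAt (I.toList.map B) e = (I.filter fun i => e ∈ B i).card := by
  unfold widthAt
  have : ((fun C => decide (e ∈ C)) ∘ B) = fun i => decide (e ∈ B i) := rfl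
  rw [List.filter_map, List.length_map, this, ← Multiset.coe_card, ← Multiset.filter_coe,
    Finset.coe_toList]
  rfl

lemma blk_of_nonbridge {e : E} (he : ¬ IsBridgeIn ends univ e) : ∃ s, Blk ends s ∧ e ∈ s := by
  by_cases hl : IsLoop ends e
  · exact ⟨{e}, Or.inl ⟨e, hl, rfl⟩, by simp⟩
  · have := mem_comp_self (mem_nbnl.2 ⟨he, hl⟩) (Sym2.out_fst_mem _)
    exact ⟨_, Or.inr ⟨⟨e, this⟩, _, rfl⟩, this⟩

lemma loop_not_bridge {e : E} (h : IsLoop ends e) : ¬ IsBridgeIn ends univ e := by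
  obtain ⟨v, hv⟩ := loop_ends h
  intro hb
  exact hb.2 v v hv Reach.rfl'

lemma blk_nonbridge {s : Finset E} (hs : Blk ends s) {e : E} (he : e ∈ s) :
    ¬ IsBridgeIn ends univ e := by
  rcases hs with ⟨f, hf, rfl⟩ | ⟨_, v, rfl⟩
  · simp at he; subst he; exact loop_not_bridge hf
  · exact (mem_nbnl.1 (comp_subset he)).1

lemma card_unb {sgn : E → Bool} :
    (univ.filter fun s : Finset E => Blk ends s ∧ Odd (negEdges sgn s).card).card =
      numUnbalancedCircuits ends sgn := by
  unfold numUnbalancedCircuits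
  have h1 : (univ.filter fun e : E => IsLoop ends e ∧ sgn e = true).card =
      ((univ.filter fun e : E => IsLoop ends e ∧ sgn e = true).image
        fun e => ({e} : Finset E)).card :=
    (Finset.card_image_of_injective _ Finset.singleton_injective).symm
  have h2 : {B : Finset E |
      (∃ v : V, B = compBalloon ends v) ∧ B.Nonempty ∧ Odd (negEdges sgn B).card} =
      ((univ.filter fun B : Finset E => (∃ v : V, B = compBalloon ends v) ∧ B.Nonempty ∧
        Odd (negEdges sgn B).card : Finset (Finset E)) : Set (Finset E)) := by
    ext; simp
  rw [h1, h2, Set.ncard_coe_finset, ← Finset.card_union_of_disjoint]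
  · congr 1
    ext s
    simp only [Finset.mem_filter, Finset.mem_univ, true_and, Finset.mem_union, Finset.mem_image]
    unfold Blk
    have hsing : ∀ e, Odd (negEdges sgn {e}).card ↔ sgn e = true := by
      intro e
      unfold negEdges
      rw [Finset.filter_singleton]
      split_ifs with h <;> simp [h]
    constructor
    · rintro ⟨⟨e, he, rfl⟩ | ⟨hne, hv⟩, ho⟩
      · exact Or.inl ⟨e, ⟨he, (hsing e).1 ho⟩, rfl⟩
      · exact Or.inr ⟨hv, hne, ho⟩
    · rintro (⟨e, ⟨he, h⟩, rfl⟩ | ⟨hv, hne, ho⟩)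
      · exact ⟨Or.inl ⟨e, he, rfl⟩, (hsing e).2 h⟩
      · exact ⟨Or.inr ⟨hne, hv⟩, ho⟩
  · rw [Finset.disjoint_left]
    intro s hs hs'
    simp only [Finset.mem_filter, Finset.mem_univ, true_and, Finset.mem_image] at hs hs'
    obtain ⟨e, ⟨he, _⟩, rfl⟩ := hs
    obtain ⟨⟨v, hv⟩, _⟩ := hs'
    have : e ∈ compBalloon ends v := by rw [← hv]; simp
    exact (mem_nbnl.1 (comp_subset this)).2 he

lemma card_bal_le {X : Finset (Finset E)} (hX : ∀ s ∈ X, Blk ends s) (e : E) :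
    (X.filter fun C => e ∈ C).card ≤ 1 := by
  rw [Finset.card_le_one]
  intro s hs s' hs'
  simp only [Finset.mem_filter] at hs hs'
  exact blk_share (hX _ hs.1) (hX _ hs'.1) hs.2 hs'.2

lemma card_bal_zero {X : Finset (Finset E)} (hX : ∀ s ∈ X, Blk ends s) {s : Finset E}
    (hs : Blk ends s) {e : E} (he : e ∈ s) (h : s ∉ X) :
    (X.filter fun C => e ∈ C).card = 0 := by
  rw [Finset.card_eq_zero, Finset.filter_eq_empty_iff]
  intro s' hs' he'
  exact h (blk_share (hX _ hs') hs he' he ▸ hs')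

lemma main_aux [Nonempty V] (sgn : E → Bool)
    (htc : IsTreeOfCircuits ends)
    (hu : Even (numUnbalancedCircuits ends sgn)) :
    ∃ 𝒞₁ 𝒞₂ 𝒞₃ : List (Finset E),
      (∀ C ∈ 𝒞₁, IsSignedCircuit ends sgn C) ∧
      (∀ C ∈ 𝒞₂, IsSignedCircuit ends sgn C) ∧
      (∀ C ∈ 𝒞₃, IsSignedCircuit ends sgn C) ∧
      (∀ e : E, ¬ IsBridgeIn ends Finset.univ e → ∃ C ∈ 𝒞₁, e ∈ C) ∧
      (∀ e : E, ¬ IsBridgeIn ends Finset.univ e → ∃ C ∈ 𝒞₂, e ∈ C) ∧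
      (∀ e : E, ¬ IsBridgeIn ends Finset.univ e → ∃ C ∈ 𝒞₃, e ∈ C) ∧
      (∀ e : E, widthAt 𝒞₁ e + widthAt 𝒞₂ e + widthAt 𝒞₃ e ≤ 4) ∧
      (∀ e : E, IsLoop ends e → sgn e = true → widthAt 𝒞₁ e = 2) := by
  rw [← card_unb] at hu
  obtain ⟨T, hTd⟩ : ∃ T, T = univ.filter fun s : Finset E =>
    Blk ends s ∧ Odd (negEdges sgn s).card := ⟨_, rfl⟩
  rw [← hTd] at hu
  have hT : ∀ s, s ∈ T ↔ Blk ends s ∧ Odd (negEdges sgn s).card := by intro s; simp [hTd]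
  clear hTd
  have hTB : ∀ s ∈ T, Blk ends s := fun s hs => ((hT s).1 hs).1
  obtain ⟨L, hLd⟩ : ∃ L, L = T.filter (OS ends T) := ⟨_, rfl⟩
  have hL : ∀ s, s ∈ L ↔ s ∈ T ∧ OS ends T s := by intro s; simp [hLd]
  clear hLd
  have hLT : L ⊆ T := fun s hs => ((hL s).1 hs).1
  obtain ⟨Z, hZd⟩ : ∃ Z, Z = univ.filter fun s : Finset E =>
    Blk ends s ∧ Even (negEdges sgn s).card := ⟨_, rfl⟩
  have hZ : ∀ s, s ∈ Z ↔ Blk ends s ∧ Even (negEdges sgn s).card := by intro s; simp [hZd]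
  clear hZd
  obtain ⟨Y, hYd⟩ : ∃ Y, Y = Z.filter (OS ends T) := ⟨_, rfl⟩
  have hY : ∀ s, s ∈ Y ↔ s ∈ Z ∧ OS ends T s := by intro s; simp [hYd]
  clear hYd
  have hZB : ∀ s ∈ Z, Blk ends s := fun s hs => ((hZ s).1 hs).1
  have hYB : ∀ s ∈ Y, Blk ends s := fun s hs => hZB s ((hY s).1 hs).1
  have hZC : ∀ s ∈ Z, IsSignedCircuit ends sgn s := fun s hs =>
    Or.inl ⟨blk_circuit htc (hZB s hs), ((hZ s).1 hs).2⟩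
  have hT1 : T.card ≠ 1 := by intro h; rw [h] at hu; exact absurd hu (by decide)
  have hL1 : L.card ≠ 1 := by
    by_cases hall : ∀ C ∈ T, OS ends T C
    · have : L = T := by ext s; rw [hL]; exact ⟨fun h => h.1, fun h => ⟨h, hall s h⟩⟩
      rwa [this]
    · push Not at hall
      obtain ⟨C, hC, hos⟩ := hall
      obtain ⟨l, hl, l', hl', o, o', n1, n2, hr⟩ := two_leaves htc hTB (hTB C hC) hos
      have hne : l ≠ l' := by
        rintro rfl
        obtain ⟨x, hx⟩ := blk_supp htc (hTB l hl)
        exact hr x hx x hx Reach.rfl'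
      intro h
      obtain ⟨z, hz⟩ := Finset.card_eq_one.1 h
      have k1 : l ∈ L := (hL l).2 ⟨hl, o⟩
      have k2 : l' ∈ L := (hL l').2 ⟨hl', o'⟩
      rw [hz, Finset.mem_singleton] at k1 k2
      exact hne (k1.trans k2.symm)
  obtain ⟨t, P, a, b, F⟩ := fam_exists htc (sgn := sgn) T (fun s hs => (hT s).1 hs) hT1
  obtain ⟨t', P', a', b', F'⟩ :=
    fam_exists htc (sgn := sgn) L (fun s hs => (hT s).1 (hLT hs)) hL1
  generalize T.card = n at *
  generalize L.card = n' at *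
  refine ⟨Y.toList ++ (range n').toList.map (BB t' P'),
    Z.toList ++ ((range n).filter Even).toList.map (BB t P),
    Z.toList ++ ((range n).filter fun i => ¬ Even i).toList.map (BB t P), ?_, ?_, ?_, ?_, ?_, ?_,
    ?_, ?_⟩
  · intro C hC
    simp only [List.mem_append, Finset.mem_toList, List.mem_map, Finset.mem_range] at hC
    rcases hC with hC | ⟨i, hi, rfl⟩
    · exact hZC C ((hY C).1 hC).1
    · exact F'.sc i hi
  · intro C hC
    simp only [List.mem_append, Finset.mem_toList, List.mem_map, Finset.mem_filter,
      Finset.mem_range] at hC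
    rcases hC with hC | ⟨i, hi, rfl⟩
    · exact hZC C hC
    · exact F.sc i hi.1
  · intro C hC
    simp only [List.mem_append, Finset.mem_toList, List.mem_map, Finset.mem_filter,
      Finset.mem_range] at hC
    rcases hC with hC | ⟨i, hi, rfl⟩
    · exact hZC C hC
    · exact F.sc i hi.1
  · intro e he
    obtain ⟨s, hs, hes⟩ := blk_of_nonbridge he
    simp only [List.mem_append, Finset.mem_toList, List.mem_map, Finset.mem_range]
    by_cases hos : OS ends T s
    · rcases Nat.even_or_odd (negEdges sgn s).card with hp | hp
      · exact ⟨s, Or.inl ((hY s).2 ⟨(hZ s).2 ⟨hs, hp⟩, hos⟩), hes⟩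
      · obtain ⟨i, hi, h⟩ := F'.surj s ((hL s).2 ⟨(hT s).2 ⟨hs, hp⟩, hos⟩)
        exact ⟨_, Or.inr ⟨i, hi, rfl⟩, mem_BB.2 (Or.inl (Or.inl (h ▸ hes)))⟩
    · obtain ⟨l, hl, l', hl', o, o', n1, n2, hr⟩ := two_leaves htc hTB hs hos
      obtain ⟨i, hi, rfl⟩ := F'.surj l ((hL l).2 ⟨hl, o⟩)
      obtain ⟨j, hj, rfl⟩ := F'.surj l' ((hL l').2 ⟨hl', o'⟩)
      have hsz : ∃ z, s = compBalloon ends z := by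
        rcases hs with ⟨f, hf, rfl⟩ | ⟨_, h⟩
        · exact absurd (loop_OS htc hf) hos
        · exact h
      obtain ⟨z, hz⟩ := hsz
      obtain ⟨k, hk, h⟩ := cover htc hs hz (fun i hi => F'.blk _ (F'.mem i hi))
        (fun i hi h => hos (h ▸ ((hL _).1 (F'.mem i hi)).2)) F'.wrap F'.sp F'.ha F'.hb
        (fun f hf => F'.cap1 f (by rw [hz] at hf; exact comp_subset hf)) hi hj hr e hes
      exact ⟨_, Or.inr ⟨k, hk, rfl⟩, mem_BB.2 (Or.inr h)⟩
  · intro e he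
    obtain ⟨s, hs, hes⟩ := blk_of_nonbridge he
    simp only [List.mem_append, Finset.mem_toList, List.mem_map, Finset.mem_filter,
      Finset.mem_range]
    rcases Nat.even_or_odd (negEdges sgn s).card with hp | hp
    · exact ⟨s, Or.inl ((hZ s).2 ⟨hs, hp⟩), hes⟩
    · obtain ⟨i₀, h1, j₀, h2, h3, h4, h5⟩ := F.pos s ((hT s).2 ⟨hs, hp⟩)
      have h4 := h4 hu
      by_cases hev : Even i₀
      · exact ⟨_, Or.inr ⟨i₀, ⟨h1, hev⟩, rfl⟩, (F.mem_iff hs hes h1).2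
          (Or.inl ((h5 _ h1).2 (Or.inl rfl)))⟩
      · exact ⟨_, Or.inr ⟨j₀, ⟨h2, by tauto⟩, rfl⟩, (F.mem_iff hs hes h2).2
          (Or.inl ((h5 _ h2).2 (Or.inr rfl)))⟩
  · intro e he
    obtain ⟨s, hs, hes⟩ := blk_of_nonbridge he
    simp only [List.mem_append, Finset.mem_toList, List.mem_map, Finset.mem_filter,
      Finset.mem_range]
    rcases Nat.even_or_odd (negEdges sgn s).card with hp | hp
    · exact ⟨s, Or.inl ((hZ s).2 ⟨hs, hp⟩), hes⟩
    · obtain ⟨i₀, h1, j₀, h2, h3, h4, h5⟩ := F.pos s ((hT s).2 ⟨hs, hp⟩)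
      have h4 := h4 hu
      by_cases hev : Even i₀
      · exact ⟨_, Or.inr ⟨j₀, ⟨h2, by tauto⟩, rfl⟩, (F.mem_iff hs hes h2).2
          (Or.inl ((h5 _ h2).2 (Or.inr rfl)))⟩
      · exact ⟨_, Or.inr ⟨i₀, ⟨h1, hev⟩, rfl⟩, (F.mem_iff hs hes h1).2
          (Or.inl ((h5 _ h1).2 (Or.inl rfl)))⟩
  · intro e
    simp only [widthAt_append, widthAt_toList, widthAt_map]
    have hsplit : (((range n).filter Even).filter fun i => e ∈ BB t P i).card +
        (((range n).filter fun i => ¬ Even i).filter fun i => e ∈ BB t P i).card =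
        ((range n).filter fun i => e ∈ BB t P i).card := by
      rw [Finset.filter_comm, Finset.filter_comm (fun i => ¬ Even i)]
      exact Finset.card_filter_add_card_filter_not _
    have y1 := card_bal_le hYB e
    have z1 := card_bal_le hZB e
    suffices hmain : (Y.filter fun C => e ∈ C).card + 2 * (Z.filter fun C => e ∈ C).card +
        ((range n').filter fun i => e ∈ BB t' P' i).card +
        ((range n).filter fun i => e ∈ BB t P i).card ≤ 4 by omega
    by_cases hb : IsBridgeIn ends univ e
    · have hno : ∀ s, Blk ends s → e ∉ s := fun s hs h => blk_nonbridge hs h hb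
      have e1 : (Y.filter fun C => e ∈ C).card = 0 := by
        rw [Finset.card_eq_zero, Finset.filter_eq_empty_iff]
        exact fun s hs => hno s (hYB s hs)
      have e2 : (Z.filter fun C => e ∈ C).card = 0 := by
        rw [Finset.card_eq_zero, Finset.filter_eq_empty_iff]
        exact fun s hs => hno s (hZB s hs)
      have e3 := (F.card_out (e := e) fun s hs => hno s (F.blk s hs)).trans (F.cap2 e)
      have e4 := (F'.card_out (e := e) fun s hs => hno s (F'.blk s hs)).trans (F'.cap2 e)
      omega
    · obtain ⟨s, hs, hes⟩ := blk_of_nonbridge hb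
      have hout : ∀ X : Finset (Finset E), (∀ u ∈ X, Blk ends u) → s ∉ X → ∀ u ∈ X, e ∉ u :=
        fun X hX hsX u hu h => hsX (blk_share (hX u hu) hs h hes ▸ hu)
      by_cases hos : OS ends T s
      · rcases Nat.even_or_odd (negEdges sgn s).card with hp | hp
        · have hsT : s ∉ T := fun h => Nat.not_even_iff_odd.2 ((hT s).1 h).2 hp
          have e3 := F.card_out (hout T F.blk hsT)
          have e4 := F'.card_out (hout L F'.blk fun h => hsT (hLT h))
          rw [F.sum_zero subset_rfl hs hos hes] at e3
          rw [F'.sum_zero hLT hs hos hes] at e4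
          omega
        · have hsT : s ∈ T := (hT s).2 ⟨hs, hp⟩
          have hsZ : s ∉ Z := fun h => Nat.not_even_iff_odd.2 hp ((hZ s).1 h).2
          have e1 := card_bal_zero hYB hs hes fun h => hsZ ((hY s).1 h).1
          have e2 := card_bal_zero hZB hs hes hsZ
          have e3 := F.card_two subset_rfl hsT hos hes
          have e4 := F'.card_two hLT ((hL s).2 ⟨hsT, hos⟩) hos hes
          omega
      · have hnb : e ∈ nbnl ends := by
          rcases hs with ⟨f, hf, rfl⟩ | ⟨_, v, rfl⟩
          · exact absurd (loop_OS htc hf) hos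
          · exact comp_subset hes
        have e1 := card_bal_zero hYB hs hes fun h => hos ((hY s).1 h).2
        have e4 := (F'.card_out (hout L F'.blk fun h => hos ((hL s).1 h).2)).trans
          (F'.cap1 e hnb)
        have c1 := F.cap1 e hnb
        rcases Nat.even_or_odd (negEdges sgn s).card with hp | hp
        · have hsT : s ∉ T := fun h => Nat.not_even_iff_odd.2 ((hT s).1 h).2 hp
          have e3 := F.card_out (hout T F.blk hsT)
          omega
        · have hsT : s ∈ T := (hT s).2 ⟨hs, hp⟩
          have hsZ : s ∉ Z := fun h => Nat.not_even_iff_odd.2 hp ((hZ s).1 h).2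
          have e2 := card_bal_zero hZB hs hes hsZ
          have e3 := F.card_in hsT hes
          omega
  · intro e hl hsg
    simp only [widthAt_append, widthAt_toList, widthAt_map]
    have hs : Blk ends {e} := Or.inl ⟨e, hl, rfl⟩
    have hp : Odd (negEdges sgn {e}).card := by
      unfold negEdges
      rw [Finset.filter_singleton, if_pos hsg]; simp
    have hes : e ∈ ({e} : Finset E) := by simp
    have hsT : {e} ∈ T := (hT _).2 ⟨hs, hp⟩
    have hos : OS ends T {e} := loop_OS htc hl
    have e1 := card_bal_zero hYB hs hes fun h =>
      Nat.not_even_iff_odd.2 hp ((hZ _).1 ((hY _).1 h).1).2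
    have e4 := F'.card_two hLT ((hL _).2 ⟨hsT, hos⟩) hos hes
    omega

end Helpers

/-- A tree of circuits with an even number of unbalanced circuits has
three weak signed circuit covers of total width at most 4, the first covering
every negative loop exactly twice. -/
theorem statement5 {V E : Type} [Fintype V] [Fintype E] [DecidableEq V] [DecidableEq E]
    (ends : E → Sym2 V) (sgn : E → Bool)
    (htc : IsTreeOfCircuits ends)
    (hu : Even (numUnbalancedCircuits ends sgn)) :
    ∃ 𝒞₁ 𝒞₂ 𝒞₃ : List (Finset E),
      (∀ C ∈ 𝒞₁, IsSignedCircuit ends sgn C) ∧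
      (∀ C ∈ 𝒞₂, IsSignedCircuit ends sgn C) ∧
      (∀ C ∈ 𝒞₃, IsSignedCircuit ends sgn C) ∧
      (∀ e : E, ¬ IsBridgeIn ends Finset.univ e → ∃ C ∈ 𝒞₁, e ∈ C) ∧
      (∀ e : E, ¬ IsBridgeIn ends Finset.univ e → ∃ C ∈ 𝒞₂, e ∈ C) ∧
      (∀ e : E, ¬ IsBridgeIn ends Finset.univ e → ∃ C ∈ 𝒞₃, e ∈ C) ∧
      (∀ e : E, widthAt 𝒞₁ e + widthAt 𝒞₂ e + widthAt 𝒞₃ e ≤ 4) ∧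
      (∀ e : E, IsLoop ends e → sgn e = true → widthAt 𝒞₁ e = 2) := by
  rcases isEmpty_or_nonempty V with hV | hV
  · have hE : IsEmpty E := ⟨fun e => hV.false (ends e).out.1⟩
    exact ⟨[], [], [], by simp, by simp, by simp, fun e => hE.elim e, fun e => hE.elim e,
      fun e => hE.elim e, fun e => hE.elim e, fun e => hE.elim e⟩
  · exact main_aux sgn htc hu

end SignedCircuitCover
end
end
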